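/- arXiv:1908.11045 — 4 statements merged into one kernel-verified Lean document; each statement's English description precedes it below -/
import Mathlib

section
/- For every integer k ≥ 8, the maximal dimension of an irreducible complex representation of the symmetric group S_k is at least 2·p(k) + 2, where p(k) denotes the number of partitions of k. -/
open CategoryTheory

namespace Nat.Partition

/-- An upper bound for the number of multisets of positive integers at most `m` with sum `n`. -/
def boundedCount : ℕ → ℕ → ℕ
  | 0, n => if n = 0 then 1 else 0
  | m + 1, n => ∑ j ∈ Finset.range (n / (m + 1) + 1), boundedCount m (n - j * (m + 1))

theorem exists_finset_card_le_boundedCount (m n : ℕ) :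
    ∃ F : Finset (Multiset ℕ), F.card ≤ boundedCount m n ∧
      ∀ s : Multiset ℕ, s.sum = n → (∀ x ∈ s, 0 < x ∧ x ≤ m) → s ∈ F := by
  induction m generalizing n with
  | zero =>
    by_cases hn : n = 0
    · refine ⟨{0}, by simp [boundedCount, hn], fun s _ hs => ?_⟩
      rw [Finset.mem_singleton]
      exact Multiset.eq_zero_of_forall_notMem fun x hx => by have := hs x hx; omega
    · refine ⟨∅, by simp, fun s hsum hs => absurd ?_ hn⟩
      have hs0 : s = 0 :=
        Multiset.eq_zero_of_forall_notMem fun x hx => by have := hs x hx; omega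
      rw [← hsum, hs0, Multiset.sum_zero]
  | succ m ih =>
    choose F hF hmem using ih
    refine ⟨(Finset.range (n / (m + 1) + 1)).biUnion fun j =>
      (F (n - j * (m + 1))).image (· + Multiset.replicate j (m + 1)), ?_, fun s hsum hs => ?_⟩
    · exact Finset.card_biUnion_le.trans
        (Finset.sum_le_sum fun j _ => Finset.card_image_le.trans (hF _))
    · have key : s.filter (¬ m + 1 = ·) + Multiset.replicate (s.count (m + 1)) (m + 1) = s := by
        rw [← Multiset.filter_eq, add_comm, Multiset.filter_add_not]
      have hsum' : (s.filter (¬ m + 1 = ·)).sum + s.count (m + 1) * (m + 1) = n := by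
        conv_rhs => rw [← hsum, ← key]
        simp
      simp only [Finset.mem_biUnion, Finset.mem_range, Finset.mem_image]
      refine ⟨s.count (m + 1), ?_, _, hmem _ _ (by omega) fun x hx => ?_, key⟩
      · rw [Nat.lt_succ_iff, Nat.le_div_iff_mul_le (by omega)]
        omega
      · rw [Multiset.mem_filter] at hx
        have := hs x hx.1
        omega

theorem card_le_boundedCount (n : ℕ) : Fintype.card (Nat.Partition n) ≤ boundedCount n n := by
  obtain ⟨F, hF, hmem⟩ := exists_finset_card_le_boundedCount n n
  refine le_trans ?_ hF
  rw [← Finset.card_univ]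
  exact Finset.card_le_card_of_injOn parts
    (fun p _ => hmem _ p.parts_sum fun x hx => ⟨p.parts_pos hx, le_of_mem_parts hx⟩)
    fun p _ q _ h => Partition.ext h

theorem card_eight_le : Fintype.card (Nat.Partition 8) ≤ 22 :=
  (card_le_boundedCount 8).trans (by decide +kernel)

theorem card_nine_le : Fintype.card (Nat.Partition 9) ≤ 30 :=
  (card_le_boundedCount 9).trans (by decide +kernel)

theorem card_succ_le (n : ℕ) :
    Fintype.card (Nat.Partition (n + 1)) ≤ 2 * Fintype.card (Nat.Partition n) := by
  have h1 : Fintype.card {p : Nat.Partition (n + 1) // 1 ∈ p.parts} =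
      Fintype.card (Nat.Partition n) :=
    Fintype.card_congr (partitionWithPartEquiv le_rfl (by omega))
  have hex : ∀ p : Nat.Partition (n + 1), ∃ a, a ∈ p.parts := fun p =>
    Multiset.exists_mem_of_ne_zero fun h => by simpa [h] using p.parts_sum
  choose a ha using hex
  have h2 : Fintype.card {p : Nat.Partition (n + 1) // 1 ∉ p.parts} ≤
      Fintype.card (Nat.Partition n) := by
    let f : {p : Nat.Partition (n + 1) // 1 ∉ p.parts} → Nat.Partition n := fun p =>
      { parts := Multiset.replicate (a p.1 - 1) 1 + p.1.parts.erase (a p.1)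
        parts_pos := fun {i} hi => by
          rcases Multiset.mem_add.1 hi with hi | hi
          · rw [Multiset.eq_of_mem_replicate hi]; exact one_pos
          · exact p.1.parts_pos (Multiset.mem_of_mem_erase hi)
        parts_sum := by
          have h := congrArg Multiset.sum (Multiset.cons_erase (ha p.1))
          rw [Multiset.sum_cons, p.1.parts_sum] at h
          have := p.1.parts_pos (ha p.1)
          simp only [Multiset.sum_add, Multiset.sum_replicate, smul_eq_mul, mul_one]
          omega }
    refine Fintype.card_le_of_injective f fun p q h => Subtype.ext (Partition.ext ?_)
    have h' : Multiset.replicate (a p.1 - 1) 1 + p.1.parts.erase (a p.1) =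
        Multiset.replicate (a q.1 - 1) 1 + q.1.parts.erase (a q.1) := congrArg parts h
    have hc := congrArg (Multiset.count 1) h'
    rw [Multiset.count_add, Multiset.count_add, Multiset.count_replicate_self,
      Multiset.count_replicate_self,
      Multiset.count_eq_zero_of_notMem fun h => p.2 (Multiset.mem_of_mem_erase h),
      Multiset.count_eq_zero_of_notMem fun h => q.2 (Multiset.mem_of_mem_erase h)] at hc
    have hp := p.1.parts_pos (ha p.1)
    have hq := q.1.parts_pos (ha q.1)
    have hpq : a p.1 = a q.1 := by omega
    rw [hpq, add_right_inj] at h'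
    rw [← Multiset.cons_erase (ha p.1), ← Multiset.cons_erase (ha q.1), hpq, h']
  have := Fintype.card_subtype_compl (fun p : Nat.Partition (n + 1) => 1 ∈ p.parts)
  have := Fintype.card_subtype_le (fun p : Nat.Partition (n + 1) => 1 ∈ p.parts)
  omega

theorem card_mul_sq_lt_factorial {n : ℕ} (hn : 9 ≤ n) :
    Fintype.card (Nat.Partition n) * (2 * Fintype.card (Nat.Partition n) + 1) ^ 2 <
      n.factorial := by
  induction n, hn using Nat.le_induction with
  | base =>
    have h := card_nine_le
    calc _ ≤ 30 * (2 * 30 + 1) ^ 2 := by gcongr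
      _ < _ := by decide
  | succ n hn ih =>
    have h := card_succ_le n
    calc _ ≤ (2 * Fintype.card (Nat.Partition n)) *
          (2 * (2 * Fintype.card (Nat.Partition n)) + 1) ^ 2 := by gcongr
      _ ≤ 8 * (Fintype.card (Nat.Partition n) *
          (2 * Fintype.card (Nat.Partition n) + 1) ^ 2) := by
        generalize Fintype.card (Nat.Partition n) = q
        nlinarith [Nat.zero_le (q * q)]
      _ < 8 * n.factorial := by omega
      _ ≤ (n + 1) * n.factorial := by gcongr; omega

end Nat.Partition

theorem exists_simple_fdRep_of_surjective {G : Type} [Group G] [Finite G] {d : ℕ} [NeZero d]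
    (f : MonoidAlgebra ℂ G →ₐ[ℂ] Matrix (Fin d) (Fin d) ℂ) (hf : Function.Surjective f) :
    ∃ π : FDRep ℂ G, Simple π ∧ Module.finrank ℂ π = d := by
  let F : MonoidAlgebra ℂ G →ₐ[ℂ] Module.End ℂ (Fin d → ℂ) :=
    (Matrix.toLinAlgEquiv' : Matrix (Fin d) (Fin d) ℂ ≃ₐ[ℂ] _).toAlgHom.comp f
  have hF : Function.Surjective F := Matrix.toLinAlgEquiv'.surjective.comp hf
  let ρ : Representation ℂ G (Fin d → ℂ) := (F : _ →* _).comp (MonoidAlgebra.of ℂ G)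
  refine ⟨FDRep.of ρ, ?_, Module.finrank_fin_fun ℂ⟩
  have : NeZero (Nat.card G : ℂ) := ⟨by simp [Nat.card_pos.ne']⟩
  rw [FDRep.simple_iff_end_is_rank_one]
  have hcomm (T : FDRep.of ρ ⟶ FDRep.of ρ) (x : MonoidAlgebra ℂ G) (v : Fin d → ℂ) :
      T.hom.hom.hom (F x v) = F x (T.hom.hom.hom v) := by
    induction x using MonoidAlgebra.induction_on with
    | of g =>
      have h := congrArg (fun A => A.hom.hom v) (T.comm g)
      have hg : F (MonoidAlgebra.of ℂ G g) = ρ g := rfl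
      rw [hg]
      exact h
    | add x y hx hy =>
      rw [map_add, LinearMap.add_apply, LinearMap.add_apply, ← hx, ← hy]
      exact map_add T.hom.hom.hom _ _
    | smul c x hx =>
      rw [map_smul, LinearMap.smul_apply, LinearMap.smul_apply, ← hx]
      exact map_smul T.hom.hom.hom _ _
  have hne : (𝟙 (FDRep.of ρ)) ≠ 0 := by
    intro h
    have h := congrArg (fun A => (A.hom.hom.hom : (Fin d → ℂ) → (Fin d → ℂ)) 1 0) h
    exact one_ne_zero (α := ℂ) h
  refine finrank_eq_one (𝟙 (FDRep.of ρ)) hne fun T => ?_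
  have hcen : (T.hom.hom.hom : Module.End ℂ (Fin d → ℂ)) ∈ Subalgebra.center ℂ (Module.End ℂ (Fin d → ℂ)) := by
    rw [Subalgebra.mem_center_iff]
    intro S
    obtain ⟨x, rfl⟩ := hF S
    exact LinearMap.ext fun v => (hcomm T x v).symm
  rw [Algebra.IsCentral.center_eq_bot, Algebra.mem_bot] at hcen
  obtain ⟨c, hc⟩ := hcen
  refine ⟨c, ?_⟩
  exact Action.Hom.ext (InducedCategory.hom_ext (ModuleCat.hom_ext hc))

theorem card_le_of_algEquiv_pi_matrix {G P ι : Type} [Group G] [Finite G] [Fintype P] [Fintype ι]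
    (c : G → P) (hc : ∀ g h, c g = c h → IsConj g h) {d : ι → ℕ} [∀ i, NeZero (d i)]
    (e : MonoidAlgebra ℂ G ≃ₐ[ℂ] Π i, Matrix (Fin (d i)) (Fin (d i)) ℂ) :
    Fintype.card ι ≤ Fintype.card P := by
  classical
  let r : P → G := Function.invFun c
  let Φ : (ι → ℂ) →ₗ[ℂ] (P → ℂ) :=
    { toFun := fun a p => (e.symm fun i => a i • 1).coeff (r p)
      map_add' := fun a b => by
        ext p
        rw [Pi.add_apply, ← Finsupp.add_apply, ← MonoidAlgebra.coeff_add, ← map_add]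
        simp only [Pi.add_apply, add_smul]
        rfl
      map_smul' := fun t a => by
        ext p
        rw [Pi.smul_apply, ← Finsupp.smul_apply, RingHom.id_apply, ← MonoidAlgebra.coeff_smul,
          ← map_smul]
        simp only [Pi.smul_apply, smul_assoc]
        rfl }
  have hΦ : Function.Injective Φ := by
    rw [injective_iff_map_eq_zero]
    intro a ha
    have hcomm (x : MonoidAlgebra ℂ G) :
        x * e.symm (fun i => a i • 1) = e.symm (fun i => a i • 1) * x := by
      apply e.injective
      ext1 i
      simp
    have hz : e.symm (fun i => a i • 1) = 0 := by
      ext g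
      obtain ⟨u, hu⟩ := isConj_iff.1 (hc (r (c g)) g (Function.invFun_eq ⟨g, rfl⟩))
      have h1 := congrArg (fun y : MonoidAlgebra ℂ G => y.coeff (u * r (c g))) (hcomm (MonoidAlgebra.single u 1))
      have h2 : (e.symm fun i => a i • 1).coeff (r (c g)) = 0 := congrFun ha (c g)
      have h3 : u * r (c g) = g * u := (mul_inv_eq_iff_eq_mul.1 hu)
      rw [MonoidAlgebra.coeff_single_mul_eq_mul_coeff (r (c g)) (by simp),
        MonoidAlgebra.coeff_mul_single_eq_coeff_mul g (by simp [h3]), h2] at h1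
      simpa using h1.symm
    have hz' : (fun i => a i • (1 : Matrix (Fin (d i)) (Fin (d i)) ℂ)) = 0 := by
      simpa using hz
    ext i
    have := congrFun (congrFun (congrFun hz' i) 0) 0
    simpa using this
  simpa using LinearMap.finrank_le_finrank_of_injective hΦ

theorem sum_sq_eq_card_of_algEquiv_pi_matrix {G ι : Type} [Group G] [Finite G] [Fintype ι]
    {d : ι → ℕ} (e : MonoidAlgebra ℂ G ≃ₐ[ℂ] Π i, Matrix (Fin (d i)) (Fin (d i)) ℂ) :
    ∑ i, d i ^ 2 = Nat.card G := by
  have := Fintype.ofFinite G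
  have h := e.toLinearEquiv.finrank_eq
  rw [Module.finrank_pi_fintype] at h
  simp only [Module.finrank_matrix, Fintype.card_fin, Module.finrank_self, mul_one] at h
  rw [Nat.card_eq_fintype_card]
  simp only [sq]
  rw [← h, Module.finrank_eq_card_basis (MonoidAlgebra.basis G ℂ)]

theorem exists_eq_one_of_algHom_pi_matrix {ι : Type} [Fintype ι] [DecidableEq ι] {d : ι → ℕ}
    [∀ i, NeZero (d i)]
    (φ : (Π i, Matrix (Fin (d i)) (Fin (d i)) ℂ) →ₐ[ℂ] ℂ) :
    ∃ i, d i = 1 ∧ ∀ x, x i = 0 → φ x = 0 := by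
  let E : ι → (Π i, Matrix (Fin (d i)) (Fin (d i)) ℂ) := fun i => Pi.single i 1
  have hE : ∑ i, φ (E i) = 1 := by
    rw [← map_sum, Finset.univ_sum_single (fun _ => 1)]
    exact map_one φ
  obtain ⟨i, -, hi⟩ := Finset.exists_ne_zero_of_sum_ne_zero (hE.trans_ne one_ne_zero)
  have hi1 : φ (E i) = 1 := by
    have : E i * E i = E i := by simp [E, ← Pi.single_mul]
    have := congrArg φ this
    rw [map_mul] at this
    exact mul_left_cancel₀ hi (by rw [this, mul_one])
  let ψ : Matrix (Fin (d i)) (Fin (d i)) ℂ →+* ℂ :=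
    { toFun := fun M => φ (Pi.single i M)
      map_one' := hi1
      map_mul' := fun M N => by rw [Pi.single_mul, map_mul]
      map_zero' := by rw [Pi.single_zero, map_zero]
      map_add' := fun M N => by rw [Pi.single_add, map_add] }
  refine ⟨i, ?_, fun x hx => ?_⟩
  · by_contra hd
    have : Nontrivial (Fin (d i)) := by
      rw [Fin.nontrivial_iff_two_le]; have := NeZero.ne (d i); omega
    obtain ⟨a, b, hab⟩ := exists_pair_ne (Fin (d i))
    have h0 : ψ (Matrix.single a b 1) * ψ (Matrix.single a b 1) = 0 := by
      rw [← map_mul, Matrix.single_mul_single_of_ne _ _ _ _ hab.symm, map_zero]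
    have h1 := (map_eq_zero_iff ψ ψ.injective).1 (mul_self_eq_zero.1 h0)
    simpa using congrFun (congrFun h1 a) b
  · have : E i * x = 0 := by
      ext1 j
      rcases eq_or_ne j i with rfl | h
      · simp [hx]
      · simp [E, h]
    rw [← one_mul (φ x), ← hi1, ← map_mul, this, map_zero]

theorem exists_ne_of_algHom_ne {A ι : Type} [Ring A] [Algebra ℂ A] [Fintype ι] {d : ι → ℕ}
    [∀ i, NeZero (d i)]
    (e : A ≃ₐ[ℂ] Π i, Matrix (Fin (d i)) (Fin (d i)) ℂ) {φ ψ : A →ₐ[ℂ] ℂ} (h : φ ≠ ψ) :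
    ∃ i j, i ≠ j ∧ d i = 1 ∧ d j = 1 := by
  classical
  obtain ⟨i, hi, hφ⟩ := exists_eq_one_of_algHom_pi_matrix (φ.comp e.symm.toAlgHom)
  obtain ⟨j, hj, hψ⟩ := exists_eq_one_of_algHom_pi_matrix (ψ.comp e.symm.toAlgHom)
  refine ⟨i, j, ?_, hi, hj⟩
  rintro rfl
  refine h (AlgHom.ext fun a => ?_)
  have : Subsingleton (Fin (d i)) := by rw [hi]; infer_instance
  have hz : (e (a - algebraMap ℂ A (e a i 0 0))) i = 0 := by
    ext p q
    rw [Subsingleton.elim p 0, Subsingleton.elim q 0]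
    simp [Algebra.algebraMap_eq_smul_one]
  have h1 := hφ _ hz
  have h2 := hψ _ hz
  simp [sub_eq_zero] at h1 h2
  rw [h1, h2]

/-- The case of `S_8`: twenty squares of integers in `[0, 45]` cannot sum to `8! - 2`. -/
theorem sum_sq_ne_factorial_eight {ι : Type} [Fintype ι] (d : ι → ℕ) (hcard : Fintype.card ι ≤ 22)
    (hle : ∀ i, d i ≤ 45) {i j : ι} (hij : i ≠ j) (hi : d i = 1) (hj : d j = 1) :
    ∑ i, d i ^ 2 ≠ 40320 := by
  classical
  intro hsum
  have hS : ∑ l, (2025 - d l ^ 2) + 40320 = 2025 * Fintype.card ι := by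
    rw [← hsum, ← Finset.sum_add_distrib, Finset.sum_congr rfl (g := fun _ => 2025)]
    · simp [mul_comm]
    · intro l _
      have : d l ^ 2 ≤ 45 ^ 2 := Nat.pow_le_pow_left (hle l) 2
      omega
  rw [← Finset.add_sum_erase _ _ (Finset.mem_univ i),
    ← Finset.add_sum_erase _ _ (Finset.mem_erase.2 ⟨hij.symm, Finset.mem_univ j⟩), hi, hj] at hS
  set s := (Finset.univ.erase i).erase j
  have hs : ∑ l ∈ s, (2025 - d l ^ 2) = 182 := by omega
  have hpos : ∀ l ∈ s, 2025 - d l ^ 2 = 0 ∨ 2025 - d l ^ 2 = 89 ∨ 2025 - d l ^ 2 = 176 := by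
    intro l hl
    have h1 : 2025 - d l ^ 2 ≤ 182 := hs ▸
      Finset.single_le_sum (f := fun l => 2025 - d l ^ 2)
        (fun _ _ => Nat.zero_le _) hl
    have h2 := hle l
    have h3 : 43 ≤ d l := by
      by_contra h
      have : d l ^ 2 ≤ 42 ^ 2 := Nat.pow_le_pow_left (by omega) 2
      omega
    interval_cases d l <;> simp
  have : ∃ a b, ∑ l ∈ s, (2025 - d l ^ 2) = 89 * a + 176 * b := by
    clear hs hS
    generalize s = t at hpos
    induction t using Finset.induction_on with
    | empty => exact ⟨0, 0, rfl⟩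
    | insert l t hl ih =>
      obtain ⟨a, b, h⟩ := ih fun l hl => hpos l (Finset.mem_insert_of_mem hl)
      rw [Finset.sum_insert hl, h]
      rcases hpos l (Finset.mem_insert_self _ _) with h | h | h <;> rw [h]
      · exact ⟨a, b, by ring⟩
      · exact ⟨a + 1, b, by ring⟩
      · exact ⟨a, b + 1, by ring⟩
  omega

theorem exists_algHom_ne_of_two_le {k : ℕ} (hk : 2 ≤ k) :
    ∃ φ ψ : MonoidAlgebra ℂ (Equiv.Perm (Fin k)) →ₐ[ℂ] ℂ, φ ≠ ψ := by
  let χ : Equiv.Perm (Fin k) →* ℂ :=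
    ((Units.coeHom ℂ).comp (Units.map (Int.castRingHom ℂ).toMonoidHom)).comp Equiv.Perm.sign
  refine ⟨MonoidAlgebra.lift ℂ ℂ _ 1, MonoidAlgebra.lift ℂ ℂ _ χ, fun h => ?_⟩
  have := (MonoidAlgebra.lift ℂ ℂ _).injective h
  have := DFunLike.congr_fun this (Equiv.swap ⟨0, by omega⟩ ⟨1, by omega⟩)
  rw [MonoidHom.one_apply] at this
  simp [χ] at this
  norm_num at this

/-- For `k ≥ 8`, the maximal dimension of an irreducible complex representation of `S_k`
is at least `2·p(k) + 2`, where `p(k)` is the number of partitions of `k`. -/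
theorem two_mul_partition_add_two_le_max_dim (k : ℕ) (hk : 8 ≤ k) :
    ∃ π : FDRep ℂ (Equiv.Perm (Fin k)), Simple π ∧
      2 * Fintype.card (Nat.Partition k) + 2 ≤ Module.finrank ℂ π := by
    classical
  obtain ⟨n, d, _, ⟨e⟩⟩ := IsSemisimpleRing.exists_algEquiv_pi_matrix_of_isAlgClosed ℂ
    (MonoidAlgebra ℂ (Equiv.Perm (Fin k)))
  by_contra! hcon
  have hd (i : Fin n) : d i ≤ 2 * Fintype.card (Nat.Partition k) + 1 := by
    obtain ⟨π, hπ, hdim⟩ := exists_simple_fdRep_of_surjective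
      ((Pi.evalAlgHom ℂ (fun i => Matrix (Fin (d i)) (Fin (d i)) ℂ) i).comp e.toAlgHom)
      ((Function.surjective_eval i).comp e.surjective)
    have := hcon π hπ
    omega
  have hn : n ≤ Fintype.card (Nat.Partition k) := by
    have h := card_le_of_algEquiv_pi_matrix (Equiv.Perm.partition (α := Fin k))
      (fun g h => Equiv.Perm.partition_eq_of_isConj.2) e
    simpa only [Fintype.card_fin] using h
  have hsum : ∑ i, d i ^ 2 = k.factorial := by
    rw [sum_sq_eq_card_of_algEquiv_pi_matrix e, Nat.card_eq_fintype_card, Fintype.card_perm,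
      Fintype.card_fin]
  rcases hk.eq_or_lt with rfl | hk
  · have h8 := Nat.Partition.card_eight_le
    obtain ⟨φ, ψ, hne⟩ := exists_algHom_ne_of_two_le (show 2 ≤ 8 by norm_num)
    obtain ⟨i, j, hij, hi, hj⟩ := exists_ne_of_algHom_ne e hne
    refine sum_sq_ne_factorial_eight d ?_ (fun l => ?_) hij hi hj hsum
    · rw [Fintype.card_fin]; omega
    · have := hd l; omega
  · refine (Nat.Partition.card_mul_sq_lt_factorial hk).not_ge ?_
    calc k.factorial = ∑ i, d i ^ 2 := hsum.symm
      _ ≤ ∑ _i : Fin n, (2 * Fintype.card (Nat.Partition k) + 1) ^ 2 :=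
        Finset.sum_le_sum fun i _ => Nat.pow_le_pow_left (hd i) 2
      _ = n * (2 * Fintype.card (Nat.Partition k) + 1) ^ 2 := by simp
      _ ≤ _ := by gcongr
end

section
/- For every integer k ≥ 12, the inequality e^{−(π/√6)·√k} · √(k!) ≥ (1/(2k√3)) · e^{π·√(2k/3)} + 2 holds; equivalently, 2k√3·e^{−(π/√6)√k}·√(k!) − 4k√3 ≥ e^{π√(2k/3)}. -/
open Real

lemma exp_pi_mul_sqrt_two_le : Real.exp (Real.pi * Real.sqrt 2) ≤ 95 := by
  have h2 : Real.sqrt 2 ≤ 1.415 := Real.sqrt_le_iff.mpr (by norm_num)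
  have hle : Real.pi * Real.sqrt 2 ≤ 9 / 2 := by
    nlinarith [Real.pi_lt_d2, Real.pi_pos, Real.sqrt_nonneg 2]
  have hexp : Real.exp (9 / 2) ^ 2 ≤ 95 ^ 2 := by
    have h : Real.exp (9 / 2) ^ 2 = Real.exp 1 ^ 9 := by
      rw [← Real.exp_nat_mul, ← Real.exp_nat_mul]; norm_num
    rw [h]
    calc Real.exp 1 ^ 9 ≤ (2.7182818286 : ℝ) ^ 9 := by
          gcongr; exact Real.exp_one_lt_d9.le
      _ ≤ 95 ^ 2 := by norm_num
  exact (Real.exp_le_exp.mpr hle).trans (le_of_sq_le_sq hexp (by norm_num))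

lemma exp_pi_div_sqrt_six_mul_sqrt_succ_le (k : ℕ) (hk : 12 ≤ k) :
    Real.exp (Real.pi / Real.sqrt 6 * Real.sqrt ((k + 1 : ℕ) : ℝ)) ≤
      Real.exp (1 / 3) * Real.exp (Real.pi / Real.sqrt 6 * Real.sqrt (k : ℝ)) := by
  have hk' : (12 : ℝ) ≤ k := by exact_mod_cast hk
  rw [← Real.exp_add, Real.exp_le_exp]
  have hc : Real.pi / Real.sqrt 6 ≤ 2 := by
    have h6 : (2 : ℝ) ≤ Real.sqrt 6 := Real.le_sqrt_of_sq_le (by norm_num)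
    rw [div_le_iff₀ (by positivity)]
    linarith [Real.pi_lt_d2]
  have hs : Real.sqrt ((k + 1 : ℕ) : ℝ) ≤ Real.sqrt (k : ℝ) + 1 / 6 := by
    have h3 : (3 : ℝ) ≤ Real.sqrt k := Real.le_sqrt_of_sq_le (by linarith)
    rw [Real.sqrt_le_iff]
    push_cast
    exact ⟨by positivity, by nlinarith [Real.sq_sqrt (by positivity : (0 : ℝ) ≤ k)]⟩
  have hc0 : 0 ≤ Real.pi / Real.sqrt 6 := by positivity
  nlinarith

/-- The inequality multiplied by `e^{(π/√6)√k}`. -/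
lemma exp_cube_div_add_le_sqrt_factorial (k : ℕ) (hk : 12 ≤ k) :
    Real.exp (Real.pi / Real.sqrt 6 * Real.sqrt (k : ℝ)) ^ 3 / (2 * (k : ℝ) * Real.sqrt 3) +
      2 * Real.exp (Real.pi / Real.sqrt 6 * Real.sqrt (k : ℝ)) ≤
        Real.sqrt (Nat.factorial k : ℝ) := by
  induction k, hk using Nat.le_induction with
  | base =>
    have harg : Real.pi / Real.sqrt 6 * Real.sqrt ((12 : ℕ) : ℝ) = Real.pi * Real.sqrt 2 := by
      have h : Real.sqrt ((12 : ℕ) : ℝ) = Real.sqrt 6 * Real.sqrt 2 := by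
        rw [← Real.sqrt_mul (by norm_num)]; norm_num
      rw [h]; field_simp
    rw [harg]
    have hE := exp_pi_mul_sqrt_two_le
    have h3 : (1.73 : ℝ) ≤ Real.sqrt 3 := Real.le_sqrt_of_sq_le (by norm_num)
    have hfac : (21800 : ℝ) ≤ Real.sqrt (Nat.factorial 12 : ℝ) :=
      Real.le_sqrt_of_sq_le (by norm_num [Nat.factorial])
    calc _ ≤ (95 : ℝ) ^ 3 / (2 * ((12 : ℕ) : ℝ) * 1.73) + 2 * 95 := by gcongr
      _ ≤ 21800 := by norm_num
      _ ≤ _ := hfac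
  | succ k hk ih =>
    have hstep := exp_pi_div_sqrt_six_mul_sqrt_succ_le k hk
    set E := Real.exp (Real.pi / Real.sqrt 6 * Real.sqrt (k : ℝ))
    have hE : 0 < E := Real.exp_pos _
    have hk0 : (12 : ℝ) ≤ k := by exact_mod_cast hk
    have hcube : Real.exp (1 / 3) ^ 3 = Real.exp 1 := by
      rw [← Real.exp_nat_mul]; norm_num
    have hthird : Real.exp (1 / 3) ≤ Real.exp 1 := Real.exp_le_exp.mpr (by norm_num)
    have hsqrt : Real.exp 1 ≤ Real.sqrt ((k : ℝ) + 1) :=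
      Real.exp_one_lt_three.le.trans (Real.le_sqrt_of_sq_le (by linarith))
    calc _ ≤ (Real.exp (1 / 3) * E) ^ 3 / (2 * (k : ℝ) * Real.sqrt 3) +
            2 * (Real.exp (1 / 3) * E) := by
          gcongr
          linarith
      _ = Real.exp 1 * (E ^ 3 / (2 * (k : ℝ) * Real.sqrt 3)) + Real.exp (1 / 3) * (2 * E) := by
          rw [mul_pow, hcube]; ring
      _ ≤ Real.exp 1 * (E ^ 3 / (2 * (k : ℝ) * Real.sqrt 3)) + Real.exp 1 * (2 * E) := by
          gcongr
      _ = Real.exp 1 * (E ^ 3 / (2 * (k : ℝ) * Real.sqrt 3) + 2 * E) := by ring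
      _ ≤ Real.sqrt ((k : ℝ) + 1) * Real.sqrt (Nat.factorial k : ℝ) := by gcongr
      _ = _ := by
          rw [← Real.sqrt_mul (by positivity), Nat.factorial_succ]; push_cast; rfl



/-- For `k ≥ 12`, `e^{−(π/√6)√k}·√(k!) ≥ (1/(2k√3))·e^{π√(2k/3)} + 2`; equivalently,
`2k√3·e^{−(π/√6)√k}·√(k!) − 4k√3 ≥ e^{π√(2k/3)}`. -/
theorem vk_lower_bound_vs_hr_upper_bound (k : ℕ) (hk : 12 ≤ k) :
    (1 / (2 * (k : ℝ) * Real.sqrt 3)) * Real.exp (Real.pi * Real.sqrt (2 * (k : ℝ) / 3)) + 2 ≤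
        Real.exp (-(Real.pi / Real.sqrt 6) * Real.sqrt (k : ℝ)) * Real.sqrt (Nat.factorial k : ℝ) ∧
      Real.exp (Real.pi * Real.sqrt (2 * (k : ℝ) / 3)) ≤
        2 * (k : ℝ) * Real.sqrt 3 *
            (Real.exp (-(Real.pi / Real.sqrt 6) * Real.sqrt (k : ℝ)) * Real.sqrt (Nat.factorial k : ℝ)) -
          4 * (k : ℝ) * Real.sqrt 3 := by
  have hk0 : (0 : ℝ) < k := by exact_mod_cast (by omega : 0 < k)
  have harg : Real.pi * Real.sqrt (2 * (k : ℝ) / 3) =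
      (2 : ℕ) * (Real.pi / Real.sqrt 6 * Real.sqrt (k : ℝ)) := by
    have h : Real.sqrt (2 * (k : ℝ) / 3) = 2 * Real.sqrt k / Real.sqrt 6 := by
      rw [Real.sqrt_eq_iff_mul_self_eq (by positivity) (by positivity), div_mul_div_comm,
        mul_mul_mul_comm, Real.mul_self_sqrt hk0.le, Real.mul_self_sqrt (by norm_num)]
      ring
    rw [h]; push_cast; ring
  have key := exp_cube_div_add_le_sqrt_factorial k hk
  rw [harg, Real.exp_nat_mul, neg_mul, Real.exp_neg]
  set E := Real.exp (Real.pi / Real.sqrt 6 * Real.sqrt (k : ℝ))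
  have hE : 0 < E := Real.exp_pos _
  have hmain : 1 / (2 * (k : ℝ) * Real.sqrt 3) * E ^ 2 + 2 ≤
      E⁻¹ * Real.sqrt (Nat.factorial k : ℝ) := by
    rw [inv_mul_eq_div, le_div_iff₀ hE]
    calc _ = E ^ 3 / (2 * (k : ℝ) * Real.sqrt 3) + 2 * E := by ring
      _ ≤ _ := key
  refine ⟨hmain, ?_⟩
  have hpos : 0 < 2 * (k : ℝ) * Real.sqrt 3 := by positivity
  have hmul := mul_le_mul_of_nonneg_left hmain hpos.le
  rw [mul_add, ← mul_assoc, mul_one_div_cancel hpos.ne', one_mul] at hmul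
  linarith
end

section
/- Let k ≥ 1 and let π_m be an irreducible complex representation of S_k of maximal dimension among all irreducible representations of S_k. If (dim π_m)² > 4·dim π_m + Σ_{ψ ≠ π_m} 2·dim ψ, where the sum runs over all irreducible representations of S_k not isomorphic to π_m, then for Γ = S_k the pair (G_3, K_3) is not a Gelfand pair. -/
noncomputable section

open CategoryTheory
open scoped TensorProduct MonoidalCategory

/-- The action of `Equiv.Perm (Fin n)` on `Fin n → Γ` permuting the factors. -/
def permHom (Γ : Type) [Group Γ] (n : ℕ) : Equiv.Perm (Fin n) →* MulAut (Fin n → Γ) where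
  toFun σ :=
    { toFun := fun f => f ∘ σ.symm
      invFun := fun f => f ∘ σ
      left_inv := fun f => by ext i; simp
      right_inv := fun f => by ext i; simp
      map_mul' := fun f g => rfl }
  map_one' := by ext f i; rfl
  map_mul' := fun σ τ => by ext f i; rfl

/-- The wreath product `Γ^n ⋊ S_n`. -/
abbrev Gn (Γ : Type) [Group Γ] (n : ℕ) := (Fin n → Γ) ⋊[permHom Γ n] Equiv.Perm (Fin n)

/-- The subgroup `K_n = Δ_n × S_n` of `G_n`, where `Δ_n` is the diagonal subgroup of `Γ^n`. -/
def Kn (Γ : Type) [Group Γ] (n : ℕ) : Subgroup (Gn Γ n) where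
  carrier := {g | ∃ γ : Γ, g.left = fun _ => γ}
  one_mem' := ⟨1, rfl⟩
  mul_mem' := by
    rintro a b ⟨γ, ha⟩ ⟨δ, hb⟩
    exact ⟨γ * δ, by simp [SemidirectProduct.mul_left, ha, hb, permHom]; rfl⟩
  inv_mem' := by
    rintro a ⟨γ, ha⟩
    exact ⟨γ⁻¹, by simp [SemidirectProduct.inv_left, ha, permHom]; rfl⟩

instance {N G : Type*} [Group N] [Group G] {φ : G →* MulAut N} [Fintype N] [Fintype G] :
    Fintype (N ⋊[φ] G) :=
  Fintype.ofEquiv (N × G)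
    { toFun := fun p => ⟨p.1, p.2⟩
      invFun := fun s => (s.left, s.right)
      left_inv := fun p => rfl
      right_inv := fun s => rfl }

/-- Convolution product on complex-valued functions on a finite group. -/
def conv {G : Type*} [Group G] [Fintype G] (f g : G → ℂ) : G → ℂ :=
  fun x => (Fintype.card G : ℂ)⁻¹ * ∑ y : G, f (x * y⁻¹) * g y

/-- A function on `G` is `K`-bi-invariant. -/
def IsBiinvariant {G : Type*} [Group G] (K : Subgroup G) (f : G → ℂ) : Prop :=
  ∀ k₁ ∈ K, ∀ k₂ ∈ K, ∀ x : G, f (k₁ * x * k₂) = f x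

/-- `(G, K)` is a Gelfand pair if the convolution algebra of `K`-bi-invariant
complex-valued functions on `G` is commutative. -/
def IsGelfandPair (G : Type*) [Group G] [Fintype G] (K : Subgroup G) : Prop :=
  ∀ f g : G → ℂ, IsBiinvariant K f → IsBiinvariant K g → conv f g = conv g f

/-- The inner product `⟨χ_τ, χ_σ⟩ = (1/|Γ|) Σ_γ χ_τ(γ) conj (χ_σ(γ))` of characters, which
computes the multiplicity of the irreducible representation `σ` in `τ`. -/
def charInner {Γ : Type} [Group Γ] [Fintype Γ] (τ σ : FDRep ℂ Γ) : ℂ :=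
  (Fintype.card Γ : ℂ)⁻¹ * ∑ γ : Γ, τ.character γ * star (σ.character γ)

/-- In a Gelfand pair `(G_n, K_n)`, functions on `Γ^n` that are invariant under permutation of the
factors and under the diagonal on both sides commute under convolution. -/
lemma IsGelfandPair.sum_comm {Γ : Type} [Group Γ] [Fintype Γ] {n : ℕ}
    (h : IsGelfandPair (Gn Γ n) (Kn Γ n)) {F F' : (Fin n → Γ) → ℂ}
    (hF : ∀ (σ : Equiv.Perm (Fin n)) (γ δ : Γ) x, F (fun t => γ * x (σ t) * δ) = F x)
    (hF' : ∀ (σ : Equiv.Perm (Fin n)) (γ δ : Γ) x, F' (fun t => γ * x (σ t) * δ) = F' x)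
    (z : Fin n → Γ) :
    ∑ y, F (z * y⁻¹) * F' y = ∑ y, F' (z * y⁻¹) * F y := by
  have biinv : ∀ H : (Fin n → Γ) → ℂ,
      (∀ (σ : Equiv.Perm (Fin n)) (γ δ : Γ) x, H (fun t => γ * x (σ t) * δ) = H x) →
      IsBiinvariant (Kn Γ n) (fun g => H g.left) := by
    rintro H hH k₁ ⟨γ, hk₁⟩ k₂ ⟨δ, hk₂⟩ x
    have := hH k₁.right.symm γ δ x.left
    refine Eq.trans ?_ this
    change H _ = H _
    congr 1
    ext t
    simp [SemidirectProduct.mul_left, hk₁, hk₂, permHom]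
  have conv_eq : ∀ H H' : (Fin n → Γ) → ℂ,
      (∀ (σ : Equiv.Perm (Fin n)) (γ δ : Γ) x, H' (fun t => γ * x (σ t) * δ) = H' x) →
      conv (fun g : Gn Γ n => H g.left) (fun g => H' g.left) ⟨z, 1⟩ =
        (Fintype.card (Gn Γ n) : ℂ)⁻¹ *
          (Fintype.card (Equiv.Perm (Fin n)) * ∑ y, H (z * y⁻¹) * H' y) := by
    intro H H' hH'
    unfold conv
    congr 1
    let e : (Fin n → Γ) × Equiv.Perm (Fin n) ≃ Gn Γ n :=
      { toFun := fun p => ⟨p.1, p.2⟩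
        invFun := fun s => (s.left, s.right)
        left_inv := fun _ => rfl
        right_inv := fun _ => rfl }
    rw [← e.sum_comp, Fintype.sum_prod_type_right]
    rw [Finset.sum_congr rfl (g := fun _ => ∑ y, H (z * y⁻¹) * H' y), Finset.sum_const,
      Finset.card_univ, nsmul_eq_mul]
    intro τ _
    rw [← (Equiv.arrowCongr τ.symm (Equiv.refl Γ)).sum_comp (fun y => H (z * y⁻¹) * H' y)]
    refine Finset.sum_congr rfl fun u _ => ?_
    congr 1
    have := hH' τ 1 1 u
    simp only [one_mul, mul_one] at this
    exact this.symm
  have key := congrFun (h _ _ (biinv F hF) (biinv F' hF')) ⟨z, 1⟩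
  rw [conv_eq F F' hF', conv_eq F' F hF] at key
  have h1 : (Fintype.card (Gn Γ n) : ℂ)⁻¹ ≠ 0 :=
    inv_ne_zero (Nat.cast_ne_zero.mpr Fintype.card_ne_zero)
  have h2 : (Fintype.card (Equiv.Perm (Fin n)) : ℂ) ≠ 0 :=
    Nat.cast_ne_zero.mpr Fintype.card_ne_zero
  exact mul_left_cancel₀ h2 (mul_left_cancel₀ h1 key)

/-- An idempotent matrix `Q` for which the corner `Q M Q` is commutative has trace `0` or `±1`. -/
lemma norm_trace_le_one_of_corner_comm {ι : Type*} [Fintype ι] [DecidableEq ι]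
    {Q : Matrix ι ι ℂ} (hQ : Q * Q = Q)
    (hcomm : ∀ S T : Matrix ι ι ℂ, Q * S * Q * (Q * T * Q) = Q * T * Q * (Q * S * Q)) :
    ‖Q.trace‖ ≤ 1 := by
  have entry : ∀ a b i j k l : ι, Q a i * Q j k * Q l b = Q a k * Q l i * Q j b := by
    intro a b i j k l
    have h := hcomm (Matrix.single i j 1) (Matrix.single k l 1)
    have e : ∀ i j k l : ι,
        (Q * Matrix.single i j (1 : ℂ) * Q * (Q * Matrix.single k l (1 : ℂ) * Q) : Matrix ι ι ℂ) a b
        = Q a i * Q j k * Q l b := by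
      intro i j k l
      have : Q * Matrix.single i j (1 : ℂ) * Q * (Q * Matrix.single k l (1 : ℂ) * Q)
          = Q * Matrix.single i j (1 : ℂ) * Q * Matrix.single k l (1 : ℂ) * Q := by
        simp only [Matrix.mul_assoc]
        rw [← Matrix.mul_assoc Q Q, hQ]
      rw [this]
      simp [Matrix.mul_apply, Matrix.single_apply, Finset.sum_ite_eq, ite_and]
    have := congrFun (congrFun h a) b
    rwa [e, e] at this
  have ht : Q.trace ^ 3 = Q.trace := by
    have h1 : Q.trace ^ 3 = ∑ a, ∑ j, ∑ l, Q a a * Q j j * Q l l := by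
      simp only [Matrix.trace, Matrix.diag, pow_succ, pow_zero, one_mul,
        Finset.sum_mul, Finset.mul_sum]
      refine Finset.sum_congr rfl fun a _ => Finset.sum_congr rfl fun j _ =>
        Finset.sum_congr rfl fun l _ => ?_
      ring
    have h2 : Q.trace = ∑ a, ∑ j, ∑ l, Q a j * Q l a * Q j l := by
      have : Q.trace = (Q * Q * Q).trace := by rw [hQ, hQ]
      rw [this]
      simp only [Matrix.trace, Matrix.diag, Matrix.mul_apply, Finset.sum_mul]
      refine Finset.sum_congr rfl fun a _ => ?_
      rw [Finset.sum_comm]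
      refine Finset.sum_congr rfl fun j _ => Finset.sum_congr rfl fun l _ => ?_
      ring
    rw [h1, h2]
    exact Finset.sum_congr rfl fun a _ => Finset.sum_congr rfl fun j _ =>
      Finset.sum_congr rfl fun l _ => entry a l a j j l
  by_contra! hlt
  have h3 : ‖Q.trace‖ ^ 3 = ‖Q.trace‖ := by rw [← norm_pow, ht]
  nlinarith [mul_pos (show 0 < ‖Q.trace‖ by linarith) (show 0 < ‖Q.trace‖ - 1 by linarith)]

lemma sum_smul_mul_sum_smul {N A : Type*} [Group N] [Fintype N] [Ring A] [Algebra ℂ A]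
    (ρ : N →* A) (F F' : N → ℂ) :
    (∑ x, F x • ρ x) * (∑ y, F' y • ρ y) = ∑ z, (∑ y, F (z * y⁻¹) * F' y) • ρ z := by
  simp only [Finset.sum_mul_sum, Finset.sum_smul]
  rw [Finset.sum_comm]
  conv_rhs => rw [Finset.sum_comm]
  refine Finset.sum_congr rfl fun y _ => ?_
  rw [← Equiv.sum_comp (Equiv.mulRight y) (fun z => (F (z * y⁻¹) * F' y) • ρ z)]
  refine Finset.sum_congr rfl fun x _ => ?_
  simp [smul_smul, mul_comm]

/-- If `(G_n, K_n)` is a Gelfand pair, then a minimal idempotent `Q` below the diagonal invariants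
of a representation of `G_n` has trace of norm at most one. Here minimality is expressed through
the scalars `χ σ` by which the permutations act on the image of `Q`. -/
lemma IsGelfandPair.norm_trace_le_one {Γ : Type} [Group Γ] [Fintype Γ] {n : ℕ}
    (h : IsGelfandPair (Gn Γ n) (Kn Γ n)) {ι : Type*} [Fintype ι] [DecidableEq ι]
    (ρ : (Fin n → Γ) →* Matrix ι ι ℂ) (P : Equiv.Perm (Fin n) →* Matrix ι ι ℂ)
    (hP : ∀ σ x, P σ * ρ x = ρ (fun t => x (σ.symm t)) * P σ)
    {E Q : Matrix ι ι ℂ} (hE : E = (Fintype.card Γ : ℂ)⁻¹ • ∑ γ, ρ (fun _ => γ))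
    (hEQ : E * Q = Q) (hQE : Q * E = Q) (hQ : Q * Q = Q)
    (χ : Equiv.Perm (Fin n) → ℂ) (hχ : ∀ σ, Q * P σ * Q = χ σ • Q)
    (hχ0 : ∑ σ, ∑ τ, χ σ * χ (σ⁻¹ * τ) * χ τ⁻¹ ≠ 0)
    (hspan : ∀ T, ∃ F : (Fin n → Γ) → ℂ, ∑ x, F x • ρ x = Q * T * Q) :
    ‖Q.trace‖ ≤ 1 := by
  have hcard : (Fintype.card Γ : ℂ) ≠ 0 := Nat.cast_ne_zero.mpr Fintype.card_ne_zero
  have hsum : ∑ γ, ρ (fun _ => γ) = (Fintype.card Γ : ℂ) • E := by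
    rw [hE, smul_smul, mul_inv_cancel₀ hcard, one_smul]
  have hsum' : ∑ γ, ρ (fun _ => γ⁻¹) = (Fintype.card Γ : ℂ) • E := by
    rw [← hsum]
    exact Equiv.sum_comp (Equiv.inv Γ) (fun γ => ρ (fun _ => γ))
  have hPE : ∀ σ, P σ * E = E * P σ := by
    intro σ
    rw [hE]
    simp only [mul_smul_comm, smul_mul_assoc, Finset.mul_sum, Finset.sum_mul, hP]
  have lift : ∀ T, ∃ F : (Fin n → Γ) → ℂ,
      (∀ (σ : Equiv.Perm (Fin n)) (γ δ : Γ) x, F (fun t => γ * x (σ t) * δ) = F x) ∧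
      ∑ x, F x • ρ x =
        ((Fintype.card Γ : ℂ) * Fintype.card Γ) • ∑ σ, P σ * (Q * T * Q) * P σ⁻¹ := by
    intro T
    obtain ⟨F₀, hF₀⟩ := hspan T
    refine ⟨fun x => ∑ σ : Equiv.Perm (Fin n), ∑ γ, ∑ δ, F₀ (fun t => γ * x (σ t) * δ), ?_, ?_⟩
    · intro σ γ δ x
      dsimp only
      rw [← Equiv.sum_comp (Equiv.mulLeft σ)
        (fun σ : Equiv.Perm (Fin n) => ∑ γ, ∑ δ, F₀ (fun t => γ * x (σ t) * δ))]
      refine Finset.sum_congr rfl fun τ _ => ?_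
      rw [← Equiv.sum_comp (Equiv.mulRight γ)
        (fun γ => ∑ δ, F₀ (fun t => γ * x (Equiv.mulLeft σ τ t) * δ))]
      refine Finset.sum_congr rfl fun γ' _ => ?_
      rw [← Equiv.sum_comp (Equiv.mulLeft δ)
        (fun δ => F₀ (fun t => Equiv.mulRight γ γ' * x (Equiv.mulLeft σ τ t) * δ))]
      refine Finset.sum_congr rfl fun δ' _ => ?_
      congr 1
      ext t
      simp [mul_assoc]
    · have single : ∀ (σ : Equiv.Perm (Fin n)) (γ δ : Γ),
          ∑ x, F₀ (fun t => γ * x (σ t) * δ) • ρ x =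
            ρ (fun _ => γ⁻¹) * (P σ * (Q * T * Q) * P σ⁻¹) * ρ (fun _ => δ⁻¹) := by
        intro σ γ δ
        let e : (Fin n → Γ) ≃ (Fin n → Γ) :=
          { toFun := fun x t => γ⁻¹ * x (σ.symm t) * δ⁻¹
            invFun := fun x t => γ * x (σ t) * δ
            left_inv := fun x => by ext t; simp [mul_assoc]
            right_inv := fun x => by ext t; simp [mul_assoc] }
        rw [← e.sum_comp, ← hF₀]
        simp only [Finset.mul_sum, Finset.sum_mul, mul_smul_comm, smul_mul_assoc]
        refine Finset.sum_congr rfl fun x _ => ?_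
        rw [hP, mul_assoc (ρ _) (P σ), ← map_mul P, mul_inv_cancel, map_one, mul_one,
          ← map_mul, ← map_mul]
        congr 1
        congr 1
        ext t
        simp [e, mul_assoc]
      simp only [Finset.sum_smul]
      rw [Finset.sum_comm, Finset.smul_sum]
      refine Finset.sum_congr rfl fun σ _ => ?_
      rw [Finset.sum_comm]
      have : ∀ γ ∈ Finset.univ,
          ∑ x, ∑ δ, F₀ (fun t => γ * x (σ t) * δ) • ρ x =
          ρ (fun _ => γ⁻¹) * (P σ * (Q * T * Q) * P σ⁻¹) * ((Fintype.card Γ : ℂ) • E) := by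
        intro γ _
        rw [Finset.sum_comm, ← hsum', Finset.mul_sum]
        exact Finset.sum_congr rfl fun δ _ => single σ γ δ
      rw [Finset.sum_congr rfl this, ← Finset.sum_mul, ← Finset.sum_mul, hsum']
      simp only [mul_smul_comm, smul_mul_assoc, smul_smul]
      congr 1
      have h1 : E * (P σ * (Q * T * Q) * P σ⁻¹) * E
          = P σ * ((E * Q) * T * (Q * E)) * P σ⁻¹ := by
        calc _ = (E * P σ) * (Q * T * Q) * (P σ⁻¹ * E) := by simp only [mul_assoc]
          _ = _ := by rw [← hPE σ, hPE σ⁻¹]; simp only [mul_assoc]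
      rw [h1, hEQ, hQE]
  have comm : ∀ S T : Matrix ι ι ℂ,
      (∑ σ, P σ * (Q * S * Q) * P σ⁻¹) * (∑ σ, P σ * (Q * T * Q) * P σ⁻¹) =
      (∑ σ, P σ * (Q * T * Q) * P σ⁻¹) * (∑ σ, P σ * (Q * S * Q) * P σ⁻¹) := by
    intro S T
    obtain ⟨F, hF, hFS⟩ := lift S
    obtain ⟨F', hF', hFT⟩ := lift T
    have h1 : (∑ x, F x • ρ x) * (∑ x, F' x • ρ x) = (∑ x, F' x • ρ x) * (∑ x, F x • ρ x) := by
      rw [sum_smul_mul_sum_smul, sum_smul_mul_sum_smul]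
      exact Finset.sum_congr rfl fun z _ => by rw [h.sum_comm hF hF' z]
    rw [hFS, hFT] at h1
    simp only [mul_smul_comm, smul_mul_assoc, smul_smul] at h1
    exact smul_right_injective _ (mul_ne_zero (mul_ne_zero hcard hcard)
      (mul_ne_zero hcard hcard)) h1
  have corner : ∀ S T : Matrix ι ι ℂ,
      Q * ((∑ σ, P σ * (Q * S * Q) * P σ⁻¹) * (∑ σ, P σ * (Q * T * Q) * P σ⁻¹)) * Q =
      (∑ σ, ∑ τ, χ σ * χ (σ⁻¹ * τ) * χ τ⁻¹) • (Q * S * Q * (Q * T * Q)) := by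
    intro S T
    simp only [Finset.mul_sum, Finset.sum_mul, Finset.sum_smul]
    rw [Finset.sum_comm]
    refine Finset.sum_congr rfl fun σ _ => Finset.sum_congr rfl fun τ _ => ?_
    have : Q * (P σ * (Q * S * Q) * P σ⁻¹ * (P τ * (Q * T * Q) * P τ⁻¹)) * Q
        = (Q * P σ * Q) * S * (Q * (P σ⁻¹ * P τ) * Q) * T * (Q * P τ⁻¹ * Q) := by
      simp only [mul_assoc]
    rw [this, ← map_mul, hχ, hχ, hχ]
    simp only [mul_smul_comm, smul_mul_assoc, smul_smul]
    congr 1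
    · ring
    · rw [mul_assoc (Q * S) Q (Q * T * Q), mul_assoc Q T Q, ← mul_assoc Q Q, hQ]
      simp only [mul_assoc]
  refine norm_trace_le_one_of_corner_comm hQ fun S T => ?_
  have := corner S T
  rw [comm, corner] at this
  exact (smul_right_injective _ hχ0 this).symm

/-- The `n`-fold external tensor power of a matrix representation. -/
def tensorRep {Γ d : Type*} [Group Γ] [Fintype d] [DecidableEq d] (ρ : Γ →* Matrix d d ℂ) (n : ℕ) :
    (Fin n → Γ) →* Matrix (Fin n → d) (Fin n → d) ℂ where
  toFun x := Matrix.of fun i j => ∏ t, ρ (x t) (i t) (j t)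
  map_one' := by
    ext i j
    simp only [Pi.one_apply, map_one, Matrix.of_apply, Matrix.one_apply]
    rw [Finset.prod_ite_zero]
    simp [funext_iff]
  map_mul' x y := by
    ext i j
    simp only [Pi.mul_apply, map_mul, Matrix.of_apply, Matrix.mul_apply]
    rw [Finset.prod_univ_sum]
    simp [Finset.prod_mul_distrib]

/-- The matrices permuting the factors of an `n`-fold tensor power. -/
def permRep (d : Type*) [Fintype d] [DecidableEq d] (n : ℕ) :
    Equiv.Perm (Fin n) →* Matrix (Fin n → d) (Fin n → d) ℂ where
  toFun σ := Matrix.of fun i j => if i ∘ σ = j then 1 else 0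
  map_one' := by
    ext i j
    simp [Matrix.one_apply]
  map_mul' σ τ := by
    ext i j
    simp only [Matrix.mul_apply, Matrix.of_apply]
    rw [Finset.sum_eq_single (i ∘ σ)]
    · rw [if_pos rfl, one_mul]
      rfl
    · intro k _ hk
      rw [if_neg hk.symm, zero_mul]
    · simp

lemma permRep_mul_tensorRep {Γ d : Type*} [Group Γ] [Fintype d] [DecidableEq d]
    (ρ : Γ →* Matrix d d ℂ) {n : ℕ} (σ : Equiv.Perm (Fin n)) (x : Fin n → Γ) :
    permRep d n σ * tensorRep ρ n x = tensorRep ρ n (fun t => x (σ.symm t)) * permRep d n σ := by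
  ext i j
  have h : ∀ k : Fin n → d, k ∘ σ = j ↔ k = j ∘ σ.symm := fun k =>
    ⟨fun h => by rw [← h]; ext; simp, fun h => by rw [h]; ext; simp⟩
  simp only [permRep, tensorRep, MonoidHom.coe_mk, OneHom.coe_mk, Matrix.mul_apply,
    Matrix.of_apply, ite_mul, one_mul, zero_mul, mul_ite, mul_one, mul_zero, h,
    Finset.sum_ite_eq, Finset.sum_ite_eq', Finset.mem_univ, if_true]
  rw [← Equiv.prod_comp σ.symm]
  simp

/-- A block diagonal family of matrices spanning all block diagonal matrix units has tensor powers
spanning all matrices which respect the block structure. -/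
lemma exists_sum_tensorRep_eq {Γ d R : Type*} [Group Γ] [Fintype Γ] [Fintype d] [DecidableEq d]
    (ρ : Γ →* Matrix d d ℂ) (ty : d → R)
    (hunit : ∀ p q, ty p = ty q → ∃ a : Γ → ℂ, ∑ γ, a γ • ρ γ = Matrix.single p q 1) {n : ℕ}
    (M : Matrix (Fin n → d) (Fin n → d) ℂ) (hM : ∀ i j, ty ∘ i ≠ ty ∘ j → M i j = 0) :
    ∃ F : (Fin n → Γ) → ℂ, ∑ x, F x • tensorRep ρ n x = M := by
  let Φ : ((Fin n → Γ) → ℂ) →ₗ[ℂ] Matrix (Fin n → d) (Fin n → d) ℂ :=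
    Fintype.linearCombination ℂ (fun x => tensorRep ρ n x)
  suffices h : M ∈ LinearMap.range Φ from h
  rw [Matrix.matrix_eq_sum_single M]
  refine Submodule.sum_mem _ fun i _ => Submodule.sum_mem _ fun j _ => ?_
  by_cases hij : ty ∘ i = ty ∘ j
  · have : Matrix.single i j (M i j) = M i j • Matrix.single i j (1 : ℂ) := by simp
    rw [this]
    refine Submodule.smul_mem _ _ ?_
    choose a ha using fun t => hunit (i t) (j t) (congrFun hij t)
    refine ⟨fun x => ∏ t, a t (x t), ?_⟩
    ext k l
    simp only [Φ, Fintype.linearCombination_apply, Matrix.sum_apply, Matrix.smul_apply,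
      tensorRep, MonoidHom.coe_mk, OneHom.coe_mk, Matrix.of_apply, smul_eq_mul]
    simp only [← Finset.prod_mul_distrib]
    have h := Finset.prod_univ_sum (fun _ : Fin n => (Finset.univ : Finset Γ))
      (fun t γ => a t γ * ρ γ (k t) (l t))
    rw [Fintype.piFinset_univ] at h
    rw [← h]
    have h2 : ∀ t, ∑ γ, a t γ * ρ γ (k t) (l t) =
        if i t = k t ∧ j t = l t then 1 else 0 := by
      intro t
      have := congrFun (congrFun (ha t) (k t)) (l t)
      simpa [Matrix.sum_apply, Matrix.single_apply] using this
    simp only [h2]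
    rw [Finset.prod_ite_zero]
    simp [Matrix.single_apply, funext_iff, forall_and]
  · rw [hM i j hij, Matrix.single_zero]
    exact Submodule.zero_mem _

/-- The projection onto the diagonal invariants of a tensor power. -/
def diagProj {Γ d : Type*} [Group Γ] [Fintype Γ] [Fintype d] [DecidableEq d]
    (ρ : Γ →* Matrix d d ℂ) (n : ℕ) : Matrix (Fin n → d) (Fin n → d) ℂ :=
  (Fintype.card Γ : ℂ)⁻¹ • ∑ γ, tensorRep ρ n (fun _ => γ)

/-- The projection onto the summand of a tensor power where the `t`-th factor lies in the block
`τ t`. -/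
def blockProj {d R : Type*} [DecidableEq d] [DecidableEq R] (ty : d → R) {n : ℕ} (τ : Fin n → R) :
    Matrix (Fin n → d) (Fin n → d) ℂ :=
  Matrix.diagonal fun i => if ty ∘ i = τ then 1 else 0

lemma trace_diagProj_mul_blockProj {Γ d R : Type*} [Group Γ] [Fintype Γ] [Fintype d]
    [DecidableEq d] [DecidableEq R] (ρ : Γ →* Matrix d d ℂ) (ty : d → R) {n : ℕ} (τ : Fin n → R) :
    (diagProj ρ n * blockProj ty τ).trace =
      (Fintype.card Γ : ℂ)⁻¹ * ∑ γ, ∏ t, ∑ p, if ty p = τ t then ρ γ p p else 0 := by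
  simp only [diagProj, blockProj, smul_mul_assoc, Matrix.trace_smul, smul_eq_mul, Finset.sum_mul,
    Matrix.trace_sum]
  congr 1
  refine Finset.sum_congr rfl fun γ _ => ?_
  rw [Finset.prod_univ_sum, Fintype.piFinset_univ]
  simp only [Matrix.trace, Matrix.diag, Matrix.mul_diagonal]
  refine Finset.sum_congr rfl fun i _ => ?_
  rw [Finset.prod_ite_zero]
  simp [tensorRep, funext_iff]

lemma diagProj_mul_self {Γ d : Type*} [Group Γ] [Fintype Γ] [Fintype d] [DecidableEq d]
    (ρ : Γ →* Matrix d d ℂ) (n : ℕ) : diagProj ρ n * diagProj ρ n = diagProj ρ n := by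
  have hcard : (Fintype.card Γ : ℂ) ≠ 0 := Nat.cast_ne_zero.mpr Fintype.card_ne_zero
  have h : ∀ γ, tensorRep ρ n (fun _ => γ) * ∑ δ, tensorRep ρ n (fun _ => δ) =
      ∑ δ, tensorRep ρ n (fun _ => δ) := by
    intro γ
    rw [Finset.mul_sum, ← Equiv.sum_comp (Equiv.mulLeft γ) (fun δ => tensorRep ρ n (fun _ => δ))]
    refine Finset.sum_congr rfl fun δ _ => ?_
    rw [← map_mul]
    rfl
  simp only [diagProj, smul_mul_assoc, mul_smul_comm, Finset.sum_mul, h, Finset.sum_const,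
    Finset.card_univ]
  rw [← Nat.cast_smul_eq_nsmul ℂ, smul_smul, smul_smul, mul_assoc, inv_mul_cancel₀ hcard, mul_one]

lemma diagProj_mul_permRep {Γ d : Type*} [Group Γ] [Fintype Γ] [Fintype d] [DecidableEq d]
    (ρ : Γ →* Matrix d d ℂ) {n : ℕ} (σ : Equiv.Perm (Fin n)) :
    Commute (diagProj ρ n) (permRep d n σ) := by
  simp only [Commute, SemiconjBy, diagProj, smul_mul_assoc, mul_smul_comm, Finset.sum_mul,
    Finset.mul_sum, permRep_mul_tensorRep]

lemma diagProj_mul_blockProj {Γ d R : Type*} [Group Γ] [Fintype Γ] [Fintype d] [DecidableEq d]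
    [DecidableEq R] (ρ : Γ →* Matrix d d ℂ) (ty : d → R)
    (hblock : ∀ γ p q, ty p ≠ ty q → ρ γ p q = 0) {n : ℕ} (τ : Fin n → R) :
    Commute (diagProj ρ n) (blockProj ty τ) := by
  simp only [Commute, SemiconjBy, diagProj, smul_mul_assoc, mul_smul_comm, Finset.sum_mul,
    Finset.mul_sum]
  congr 1
  refine Finset.sum_congr rfl fun γ _ => ?_
  ext i j
  simp only [blockProj, Matrix.mul_diagonal, Matrix.diagonal_mul]
  by_cases hij : ty ∘ i = ty ∘ j
  · rw [hij, mul_comm]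
  · obtain ⟨t, ht⟩ := Function.ne_iff.mp hij
    have : tensorRep ρ n (fun _ => γ) i j = 0 :=
      Finset.prod_eq_zero (Finset.mem_univ t) (hblock γ _ _ ht)
    rw [this, zero_mul, mul_zero]

lemma blockProj_mul_self {d R : Type*} [Fintype d] [DecidableEq d] [DecidableEq R] (ty : d → R)
    {n : ℕ} (τ : Fin n → R) : blockProj ty τ * blockProj ty τ = blockProj ty τ := by
  simp [blockProj, Matrix.diagonal_mul_diagonal]

lemma blockProj_mul_permRep_of_eq {d R : Type*} [Fintype d] [DecidableEq d] [DecidableEq R]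
    (ty : d → R) {n : ℕ} {τ : Fin n → R} {σ : Equiv.Perm (Fin n)} (h : τ ∘ σ = τ) :
    Commute (blockProj ty τ) (permRep d n σ) := by
  ext i j
  simp only [blockProj, Matrix.mul_diagonal, Matrix.diagonal_mul, permRep, MonoidHom.coe_mk,
    OneHom.coe_mk, Matrix.of_apply]
  by_cases hij : i ∘ σ = j
  · have : ty ∘ j = τ ↔ ty ∘ i = τ := by
      rw [← hij, ← Function.comp_assoc]
      conv_lhs => rw [← h]
      exact σ.surjective.injective_comp_right.eq_iff
    simp [hij, this]
  · simp [hij]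

lemma blockProj_mul_permRep_of_ne {d R : Type*} [Fintype d] [DecidableEq d] [DecidableEq R]
    (ty : d → R) {n : ℕ} {τ : Fin n → R} {σ : Equiv.Perm (Fin n)} (h : τ ∘ σ ≠ τ) :
    blockProj ty τ * permRep d n σ * blockProj ty τ = 0 := by
  ext i j
  simp only [blockProj, Matrix.mul_diagonal, Matrix.diagonal_mul, permRep, MonoidHom.coe_mk,
    OneHom.coe_mk, Matrix.of_apply, Matrix.zero_apply]
  by_cases hij : i ∘ σ = j
  · by_cases hi : ty ∘ i = τ
    · have : ty ∘ j ≠ τ := by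
        rw [← hij, ← Function.comp_assoc, hi]
        exact h
      simp [this]
    · simp [hi]
  · simp [hij]

/-- A rational combination of permutation matrices, with denominator `6`. -/
def permComb (d : Type*) [Fintype d] [DecidableEq d] {n : ℕ} (a : Equiv.Perm (Fin n) → ℤ) :
    Matrix (Fin n → d) (Fin n → d) ℂ :=
  ∑ σ, ((a σ : ℂ) / 6) • permRep d n σ

lemma permComb_mul_permRep_mul_permComb (d : Type*) [Fintype d] [DecidableEq d] {n : ℕ}
    (a : Equiv.Perm (Fin n) → ℤ) (σ : Equiv.Perm (Fin n)) (c : ℤ)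
    (h : ∀ κ, ∑ α, a α * a ((α * σ)⁻¹ * κ) = 3 * c * a κ) :
    permComb d a * permRep d n σ * permComb d a = ((c : ℂ) / 2) • permComb d a := by
  have h1 : ∀ α, permRep d n α * permRep d n σ * permComb d a =
      ∑ κ, ((a ((α * σ)⁻¹ * κ) : ℂ) / 6) • permRep d n κ := by
    intro α
    rw [permComb, Finset.mul_sum, ← Equiv.sum_comp (Equiv.mulLeft (α * σ))
      (fun κ => ((a ((α * σ)⁻¹ * κ) : ℂ) / 6) • permRep d n κ)]
    refine Finset.sum_congr rfl fun β _ => ?_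
    simp only [Equiv.coe_mulLeft, map_mul, mul_smul_comm, inv_mul_cancel_left]
  have h2 : permComb d a * permRep d n σ * permComb d a =
      ∑ α, ((a α : ℂ) / 6) • (permRep d n α * permRep d n σ * permComb d a) := by
    conv_lhs => enter [1, 1]; rw [permComb]
    simp only [Finset.sum_mul, smul_mul_assoc]
  rw [h2]
  simp only [h1, Finset.smul_sum, smul_smul]
  rw [Finset.sum_comm, permComb, Finset.smul_sum]
  refine Finset.sum_congr rfl fun κ _ => ?_
  rw [← Finset.sum_smul, smul_smul]
  congr 1
  have h3 : ∑ α, (a α : ℂ) * a ((α * σ)⁻¹ * κ) = 3 * c * a κ := by exact_mod_cast h κ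
  have h4 : ∀ α, (a α : ℂ) / 6 * (a ((α * σ)⁻¹ * κ) / 6) =
      (a α * a ((α * σ)⁻¹ * κ)) * (1 / 36) := fun α => by ring
  simp only [h4]
  rw [← Finset.sum_mul, h3]
  ring

/-- In a Gelfand pair `(G_n, K_n)`, each primitive idempotent of the group algebra of the
stabilizer of `τ` cuts the diagonal invariants in the block `τ` down to a space of dimension at
most one. -/
lemma IsGelfandPair.norm_trace_permComb_le_one {Γ : Type} [Group Γ] [Fintype Γ] {n : ℕ}
    (h : IsGelfandPair (Gn Γ n) (Kn Γ n)) {d R : Type*} [Fintype d] [DecidableEq d]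
    [DecidableEq R] (ρ : Γ →* Matrix d d ℂ) (ty : d → R)
    (hblock : ∀ γ p q, ty p ≠ ty q → ρ γ p q = 0)
    (hunit : ∀ p q, ty p = ty q → ∃ a : Γ → ℂ, ∑ γ, a γ • ρ γ = Matrix.single p q 1)
    (τ : Fin n → R) (a χ : Equiv.Perm (Fin n) → ℤ)
    (ha : ∀ σ, a σ ≠ 0 → τ ∘ σ = τ) (hχ : ∀ σ, χ σ ≠ 0 → τ ∘ σ = τ)
    (haχ : ∀ σ : Equiv.Perm (Fin n), τ ∘ σ = τ → ∀ κ, ∑ α, a α * a ((α * σ)⁻¹ * κ) = 3 * χ σ * a κ)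
    (hχ1 : χ 1 = 2) (hχ0 : ∑ σ, ∑ τ, χ σ * χ (σ⁻¹ * τ) * χ τ⁻¹ ≠ 0) :
    ‖(diagProj ρ n * blockProj ty τ * permComb d a).trace‖ ≤ 1 := by
  set E := diagProj ρ n with hE
  set D := blockProj ty τ with hD
  set e := permComb d a with he
  have hED : Commute E D := diagProj_mul_blockProj ρ ty hblock τ
  have hEP : ∀ σ, Commute E (permRep d n σ) := diagProj_mul_permRep ρ
  have hEe : Commute E e :=
    Commute.sum_right _ _ _ fun σ _ => (hEP σ).smul_right _
  have hDe : Commute D e := by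
    refine Commute.sum_right _ _ _ fun σ _ => ?_
    by_cases hσ : a σ = 0
    · rw [hσ]
      simp
    · exact (blockProj_mul_permRep_of_eq ty (ha σ hσ)).smul_right _
  have hEE : E * E = E := diagProj_mul_self ρ n
  have hDD : D * D = D := blockProj_mul_self ty τ
  have hePe : ∀ σ, D * (e * permRep d n σ * e) * D = ((χ σ : ℂ) / 2) • (D * e) := by
    intro σ
    by_cases hσ : τ ∘ σ = τ
    · rw [he, permComb_mul_permRep_mul_permComb d a σ (χ σ) (haχ σ hσ), ← he, mul_smul_comm,
        smul_mul_assoc, mul_assoc, ← hDe.eq, ← mul_assoc, hDD]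
    · have h0 : χ σ = 0 := by_contra fun h0 => hσ (hχ σ h0)
      calc _ = (D * e) * permRep d n σ * (e * D) := by simp only [mul_assoc]
        _ = (e * D) * permRep d n σ * (D * e) := by rw [← hDe.eq]
        _ = e * (D * permRep d n σ * D) * e := by simp only [mul_assoc]
        _ = _ := by rw [blockProj_mul_permRep_of_ne ty hσ, h0]; simp
  have hQPQ : ∀ σ, E * D * e * permRep d n σ * (E * D * e) = ((χ σ : ℂ) / 2) • (E * D * e) := by
    intro σ
    have hcomm : Commute E (D * e * permRep d n σ) := (hED.mul_right hEe).mul_right (hEP σ)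
    calc _ = E * ((D * e * permRep d n σ) * E) * (D * e) := by simp only [mul_assoc]
      _ = (E * E) * (D * e * permRep d n σ) * (D * e) := by rw [← hcomm.eq]; simp only [mul_assoc]
      _ = (E * E) * (D * e * permRep d n σ) * (e * D) := by rw [hDe.eq]
      _ = (E * E) * (D * (e * permRep d n σ * e) * D) := by simp only [mul_assoc]
      _ = _ := by rw [hEE, hePe, mul_smul_comm, mul_assoc]
  have hQ : E * D * e * (E * D * e) = E * D * e := by
    have := hQPQ 1
    rw [map_one, mul_one, hχ1] at this
    simpa using this
  refine h.norm_trace_le_one (tensorRep ρ n) (permRep d n) (permRep_mul_tensorRep ρ) (E := E) rfl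
    ?_ ?_ hQ (fun σ => (χ σ : ℂ) / 2) hQPQ ?_ ?_
  · simp only [← mul_assoc, hEE]
  · rw [mul_assoc, ← hEe.eq, mul_assoc, ← mul_assoc D, ← hED.eq, mul_assoc, ← mul_assoc, hEE]
  · have h8 : ∑ σ, ∑ τ, (χ σ : ℂ) / 2 * (χ (σ⁻¹ * τ) / 2) * (χ τ⁻¹ / 2) =
        (∑ σ, ∑ τ, (χ σ : ℂ) * χ (σ⁻¹ * τ) * χ τ⁻¹) * (1 / 8) := by
      simp only [Finset.sum_mul]
      refine Finset.sum_congr rfl fun σ _ => Finset.sum_congr rfl fun τ _ => ?_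
      ring
    rw [h8]
    refine mul_ne_zero ?_ (by norm_num)
    exact_mod_cast hχ0
  · intro T
    refine exists_sum_tensorRep_eq ρ ty hunit _ fun i j hij => ?_
    have h1 : E * D * e * T * (E * D * e) = D * (E * e * T * E * e) * D := by
      have h2 : E * D * e = E * e * D := by rw [mul_assoc, hDe.eq, mul_assoc]
      have h3 : E * D * e = D * (E * e) := by rw [hED.eq, mul_assoc]
      calc _ = D * (E * e) * T * (E * e * D) := by rw [← h3, ← h2]
        _ = _ := by simp only [mul_assoc]
    rw [h1]
    simp only [hD, blockProj, Matrix.mul_diagonal, Matrix.diagonal_mul]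
    by_cases hi : ty ∘ i = τ
    · have hj : ty ∘ j ≠ τ := fun hj => hij (hi.trans hj.symm)
      simp [hj]
    · simp [hi]

/-- The coefficients of six times the primitive idempotents of the stabilizer of the point `2` in
`S_3`, for the trivial (`ε = 1`) and the sign (`ε = -1`) character. -/
def stabCoeff (ε : ℤ) (σ : Equiv.Perm (Fin 3)) : ℤ :=
  if σ 2 = 2 then if σ 0 = 0 then 3 else 3 * ε else 0

/-- The scalars by which `S_3` acts on the idempotents of `stabCoeff`, multiplied by two. -/
def stabScalar (ε : ℤ) (σ : Equiv.Perm (Fin 3)) : ℤ :=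
  if σ 2 = 2 then if σ 0 = 0 then 2 else 2 * ε else 0

/-- The coefficients of six times a primitive idempotent of `S_3` belonging to the
two-dimensional irreducible representation. -/
def stdCoeff (σ : Equiv.Perm (Fin 3)) : ℤ :=
  if σ 2 = 2 then 2 else -1

/-- The sign of a permutation of three letters as an integer. -/
def sgn (σ : Equiv.Perm (Fin 3)) : ℤ := (Equiv.Perm.sign σ : ℤˣ)

lemma stabCoeff_mul : ∀ ε ∈ ({1, -1} : Finset ℤ), ∀ σ : Equiv.Perm (Fin 3), σ 2 = 2 → ∀ κ,
    ∑ α, stabCoeff ε α * stabCoeff ε ((α * σ)⁻¹ * κ) = 3 * stabScalar ε σ * stabCoeff ε κ := by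
  decide +kernel

lemma stabScalar_sum : ∀ ε ∈ ({1, -1} : Finset ℤ),
    ∑ σ, ∑ τ, stabScalar ε σ * stabScalar ε (σ⁻¹ * τ) * stabScalar ε τ⁻¹ ≠ 0 := by
  decide +kernel

lemma stdCoeff_mul : ∀ σ κ : Equiv.Perm (Fin 3),
    ∑ α, stdCoeff α * stdCoeff ((α * σ)⁻¹ * κ) = 3 * stdCoeff σ * stdCoeff κ := by
  decide +kernel

lemma stdCoeff_sum :
    ∑ σ, ∑ τ, stdCoeff σ * stdCoeff (σ⁻¹ * τ) * stdCoeff τ⁻¹ ≠ 0 := by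
  decide +kernel

lemma sgn_mul_stdCoeff_mul : ∀ σ κ : Equiv.Perm (Fin 3),
    ∑ α, sgn α * stdCoeff α * (sgn ((α * σ)⁻¹ * κ) * stdCoeff ((α * σ)⁻¹ * κ)) =
      3 * (sgn σ * stdCoeff σ) * (sgn κ * stdCoeff κ) := by
  decide +kernel

lemma sgn_mul_stdCoeff_sum :
    ∑ σ, ∑ τ, sgn σ * stdCoeff σ * (sgn (σ⁻¹ * τ) * stdCoeff (σ⁻¹ * τ)) *
      (sgn τ⁻¹ * stdCoeff τ⁻¹) ≠ 0 := by
  decide +kernel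

lemma sgn_sum : ∀ σ κ : Equiv.Perm (Fin 3),
    ∑ α, sgn α * sgn ((α * σ)⁻¹ * κ) = 3 * (2 * sgn σ) * sgn κ := by
  decide +kernel

lemma sgn_sum_sum :
    ∑ σ, ∑ τ, 2 * sgn σ * (2 * sgn (σ⁻¹ * τ)) * (2 * sgn τ⁻¹) ≠ 0 := by
  decide +kernel

lemma one_sum_sum :
    ∑ _σ : Equiv.Perm (Fin 3), ∑ _τ : Equiv.Perm (Fin 3), (2 * 2 * 2 : ℤ) ≠ 0 := by
  decide +kernel

lemma permComb_eq_one {d : Type*} [Fintype d] [DecidableEq d] {a : Equiv.Perm (Fin 3) → ℤ}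
    (ha : ∀ σ, a σ = if σ = 1 then 6 else 0) : permComb d a = 1 := by
  simp [permComb, ha, ite_div]

lemma permComb_add (d : Type*) [Fintype d] [DecidableEq d] {n : ℕ}
    (a b : Equiv.Perm (Fin n) → ℤ) : permComb d (a + b) = permComb d a + permComb d b := by
  simp [permComb, add_div, add_smul, Finset.sum_add_distrib]

/-- The multiplicity of the trivial representation in `V ⊗ V ⊗ W`, with `V` the block `r₀`
and `W` the block `r ≠ r₀`, is at most two if `(G_3, K_3)` is a Gelfand pair. -/
lemma IsGelfandPair.norm_le_two {Γ : Type} [Group Γ] [Fintype Γ]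
    (h : IsGelfandPair (Gn Γ 3) (Kn Γ 3)) {d R : Type*} [Fintype d] [DecidableEq d]
    [DecidableEq R] (ρ : Γ →* Matrix d d ℂ) (ty : d → R)
    (hblock : ∀ γ p q, ty p ≠ ty q → ρ γ p q = 0)
    (hunit : ∀ p q, ty p = ty q → ∃ a : Γ → ℂ, ∑ γ, a γ • ρ γ = Matrix.single p q 1)
    {r₀ r : R} (hr : r ≠ r₀) :
    ‖(diagProj ρ 3 * blockProj ty ![r₀, r₀, r]).trace‖ ≤ 2 := by
  have hstab : ∀ σ : Equiv.Perm (Fin 3), ![r₀, r₀, r] ∘ σ = ![r₀, r₀, r] ↔ σ 2 = 2 := by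
    have himg : ∀ i : Fin 3, ![r₀, r₀, r] i = if i = 2 then r else r₀ := by
      intro i
      fin_cases i <;> simp
    intro σ
    constructor
    · intro hσ
      have := congrFun hσ 2
      rw [Function.comp_apply, himg, himg] at this
      by_contra h2
      simp [h2] at this
      exact hr this.symm
    · intro hσ
      ext i
      have : σ i = 2 ↔ i = 2 := by
        conv_lhs => rw [← hσ]
        exact σ.injective.eq_iff
      simp [himg, this]
  have bound : ∀ ε ∈ ({1, -1} : Finset ℤ),
      ‖(diagProj ρ 3 * blockProj ty ![r₀, r₀, r] * permComb d (stabCoeff ε)).trace‖ ≤ 1 := by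
    intro ε hε
    refine h.norm_trace_permComb_le_one ρ ty hblock hunit _ (stabCoeff ε) (stabScalar ε)
      (fun σ hσ => ?_) (fun σ hσ => ?_) (fun σ hσ => ?_) (by simp [stabScalar])
      (stabScalar_sum ε hε)
    · rw [hstab]
      by_contra h2
      simp [stabCoeff, h2] at hσ
    · rw [hstab]
      by_contra h2
      simp [stabScalar, h2] at hσ
    · exact stabCoeff_mul ε hε σ ((hstab σ).mp hσ)
  have hone : permComb d (stabCoeff 1) + permComb d (stabCoeff (-1)) = 1 := by
    rw [← permComb_add]
    exact permComb_eq_one (by decide +kernel)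
  calc _ = ‖(diagProj ρ 3 * blockProj ty ![r₀, r₀, r] * permComb d (stabCoeff 1)).trace +
        (diagProj ρ 3 * blockProj ty ![r₀, r₀, r] * permComb d (stabCoeff (-1))).trace‖ := by
        rw [← Matrix.trace_add, ← mul_add, hone, mul_one]
    _ ≤ _ := (norm_add_le _ _).trans
        (by linarith [bound 1 (by simp), bound (-1) (by simp)])

/-- The multiplicity of the trivial representation in `V ⊗ V ⊗ V`, with `V` the block `r`, is at
most four if `(G_3, K_3)` is a Gelfand pair. -/
lemma IsGelfandPair.norm_le_four {Γ : Type} [Group Γ] [Fintype Γ]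
    (h : IsGelfandPair (Gn Γ 3) (Kn Γ 3)) {d R : Type*} [Fintype d] [DecidableEq d]
    [DecidableEq R] (ρ : Γ →* Matrix d d ℂ) (ty : d → R)
    (hblock : ∀ γ p q, ty p ≠ ty q → ρ γ p q = 0)
    (hunit : ∀ p q, ty p = ty q → ∃ a : Γ → ℂ, ∑ γ, a γ • ρ γ = Matrix.single p q 1) (r : R) :
    ‖(diagProj ρ 3 * blockProj ty ![r, r, r]).trace‖ ≤ 4 := by
  have hstab : ∀ σ : Equiv.Perm (Fin 3), ![r, r, r] ∘ σ = ![r, r, r] := by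
    have himg : ∀ i : Fin 3, ![r, r, r] i = r := by
      intro i
      fin_cases i <;> simp
    intro σ
    ext i
    simp [himg]
  have bound : ∀ a χ : Equiv.Perm (Fin 3) → ℤ,
      (∀ σ κ, ∑ α, a α * a ((α * σ)⁻¹ * κ) = 3 * χ σ * a κ) → χ 1 = 2 →
      ∑ σ, ∑ τ, χ σ * χ (σ⁻¹ * τ) * χ τ⁻¹ ≠ 0 →
      ‖(diagProj ρ 3 * blockProj ty ![r, r, r] * permComb d a).trace‖ ≤ 1 :=
    fun a χ haχ hχ1 hχ0 => h.norm_trace_permComb_le_one ρ ty hblock hunit _ a χ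
      (fun σ _ => hstab σ) (fun σ _ => hstab σ) (fun σ _ => haχ σ) hχ1 hχ0
  have b₁ := bound (fun _ => 1) (fun _ => 2) (by decide +kernel) rfl one_sum_sum
  have b₂ := bound sgn (fun σ => 2 * sgn σ) sgn_sum (by simp [sgn]) sgn_sum_sum
  have b₃ := bound stdCoeff stdCoeff stdCoeff_mul (by simp [stdCoeff]) stdCoeff_sum
  have b₄ := bound (fun σ => sgn σ * stdCoeff σ) (fun σ => sgn σ * stdCoeff σ)
    sgn_mul_stdCoeff_mul (by simp [sgn, stdCoeff]) sgn_mul_stdCoeff_sum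
  have hone : permComb d (fun _ : Equiv.Perm (Fin 3) => 1) + permComb d sgn +
      permComb d stdCoeff + permComb d (fun σ => sgn σ * stdCoeff σ) = 1 := by
    rw [← permComb_add, ← permComb_add, ← permComb_add]
    exact permComb_eq_one (by decide +kernel)
  have htr : (diagProj ρ 3 * blockProj ty ![r, r, r]).trace =
      (diagProj ρ 3 * blockProj ty ![r, r, r] * permComb d (fun _ => 1)).trace +
      (diagProj ρ 3 * blockProj ty ![r, r, r] * permComb d sgn).trace +
      (diagProj ρ 3 * blockProj ty ![r, r, r] * permComb d stdCoeff).trace +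
      (diagProj ρ 3 * blockProj ty ![r, r, r] *
        permComb d (fun σ => sgn σ * stdCoeff σ)).trace := by
    rw [← Matrix.trace_add, ← Matrix.trace_add, ← Matrix.trace_add, ← mul_add, ← mul_add,
      ← mul_add, hone, mul_one]
  rw [htr]
  refine (norm_add₄_le).trans ?_
  linarith

/-- The morphism of `FDRep` given by an equivariant linear map. -/
def FDRep.homOfCommute {Γ : Type} [Group Γ] {V W : FDRep ℂ Γ} (T : V →ₗ[ℂ] W)
    (hT : ∀ γ, T ∘ₗ V.ρ γ = W.ρ γ ∘ₗ T) : V ⟶ W :=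
  ⟨InducedCategory.homMk (ModuleCat.ofHom T), fun γ => by
    ext1
    exact hT γ⟩

lemma FDRep.homOfCommute_injective {Γ : Type} [Group Γ] {V W : FDRep ℂ Γ} {S T : V →ₗ[ℂ] W}
    (hS : ∀ γ, S ∘ₗ V.ρ γ = W.ρ γ ∘ₗ S) (hT : ∀ γ, T ∘ₗ V.ρ γ = W.ρ γ ∘ₗ T)
    (h : homOfCommute S hS = homOfCommute T hT) : S = T :=
  congrArg (fun f : V ⟶ W => f.hom.hom.hom) h

lemma FDRep.average_commute {Γ : Type} [Group Γ] [Fintype Γ] (V W : FDRep ℂ Γ) (T : V →ₗ[ℂ] W)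
    (δ : Γ) : (∑ γ, W.ρ γ ∘ₗ T ∘ₗ V.ρ γ⁻¹) ∘ₗ V.ρ δ = W.ρ δ ∘ₗ ∑ γ, W.ρ γ ∘ₗ T ∘ₗ V.ρ γ⁻¹ := by
  ext v
  simp only [LinearMap.comp_apply, LinearMap.sum_apply, map_sum]
  rw [← Equiv.sum_comp (Equiv.mulLeft δ)]
  refine Finset.sum_congr rfl fun γ _ => ?_
  simp only [Equiv.coe_mulLeft, mul_inv_rev, map_mul, Module.End.mul_apply]
  rw [← Module.End.mul_apply (V.ρ δ⁻¹), ← map_mul, inv_mul_cancel, map_one, Module.End.one_apply]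

lemma FDRep.average_eq_zero {Γ : Type} [Group Γ] [Fintype Γ] (V W : FDRep ℂ Γ) [Simple V]
    [Simple W] (h : ¬ Nonempty (V ≅ W)) (T : V →ₗ[ℂ] W) :
    ∑ γ, W.ρ γ ∘ₗ T ∘ₗ V.ρ γ⁻¹ = 0 := by
  have h0 := FDRep.finrank_hom_simple_simple V W
  rw [if_neg h] at h0
  have := Module.finrank_zero_iff.mp h0
  exact homOfCommute_injective (FDRep.average_commute V W T) (by simp) (Subsingleton.elim _ _)

lemma FDRep.exists_average_eq_smul {Γ : Type} [Group Γ] [Fintype Γ] (V : FDRep ℂ Γ) [Simple V]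
    (T : V →ₗ[ℂ] V) : ∃ c : ℂ, ∑ γ, V.ρ γ ∘ₗ T ∘ₗ V.ρ γ⁻¹ = c • LinearMap.id := by
  obtain ⟨c, hc⟩ := (finrank_eq_one_iff_of_nonzero' (𝟙 V) (id_nonzero V)).mp
    (finrank_endomorphism_simple_eq_one ℂ V) (homOfCommute _ (FDRep.average_commute V V T))
  exact ⟨c, congrArg (fun f : V ⟶ V => f.hom.hom.hom) hc.symm⟩

/-- The representation of a finite group on a simple module over its group algebra is simple. -/
lemma FDRep.simple_of_isSimpleModule {Γ : Type} [Group Γ] [Fintype Γ] (M : Type)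
    [AddCommGroup M] [Module ℂ M] [Module.Finite ℂ M] [Module (MonoidAlgebra ℂ Γ) M]
    [IsScalarTower ℂ (MonoidAlgebra ℂ Γ) M] [IsSimpleModule (MonoidAlgebra ℂ Γ) M] :
    Simple (FDRep.of (Representation.ofModule' (k := ℂ) (G := Γ) M)) := by
  have : NeZero (Nat.card Γ : ℂ) := ⟨Nat.cast_ne_zero.mpr Nat.card_pos.ne'⟩
  rw [FDRep.simple_iff_end_is_rank_one]
  set V := FDRep.of (Representation.ofModule' (k := ℂ) (G := Γ) M)
  have hnt : Nontrivial M := IsSimpleModule.nontrivial (MonoidAlgebra ℂ Γ) M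
  refine finrank_eq_one (𝟙 V) (fun h0 => ?_) fun f => ?_
  · obtain ⟨v, hv⟩ := exists_ne (0 : M)
    have : (LinearMap.id : M →ₗ[ℂ] M) = 0 := congrArg (fun f : V ⟶ V => f.hom.hom.hom) h0
    exact hv (LinearMap.congr_fun this v)
  · let T : M →ₗ[ℂ] M := f.hom.hom.hom
    have hT : ∀ (γ : Γ) (v : M), T (MonoidAlgebra.single γ (1 : ℂ) • v) =
        MonoidAlgebra.single γ (1 : ℂ) • T v := fun γ v =>
      congrArg (fun g : V.V ⟶ V.V => g.hom.hom v) (f.comm γ)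
    let S : M →ₗ[MonoidAlgebra ℂ Γ] M :=
      { toFun := T
        map_add' := map_add T
        map_smul' := fun x v => by
          induction x using MonoidAlgebra.induction_on with
          | of γ => exact hT γ v
          | add x y hx hy => simp only [add_smul, map_add, hx, hy]
          | smul c x hx => simp only [RingHom.id_apply] at hx ⊢; simp only [smul_assoc, map_smul, hx] }
    obtain ⟨c, hc⟩ := (IsSimpleModule.algebraMap_end_bijective_of_isAlgClosed ℂ).2 S
    refine ⟨c, ?_⟩
    have : c • LinearMap.id = T := by
      ext v
      exact LinearMap.congr_fun hc v
    ext v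
    exact LinearMap.congr_fun this v

/-- A function on a finite group which acts by zero on every simple representation vanishes. -/
lemma eq_zero_of_forall_simple {Γ : Type} [Group Γ] [Fintype Γ] (a : Γ → ℂ)
    (ha : ∀ V : FDRep ℂ Γ, Simple V → ∑ γ, a γ • V.ρ γ = 0) : a = 0 := by
  have : NeZero (Nat.card Γ : ℂ) := ⟨Nat.cast_ne_zero.mpr Nat.card_pos.ne'⟩
  classical
  let x : MonoidAlgebra ℂ Γ := ∑ γ, MonoidAlgebra.single γ (a γ)
  have hx : x ∈ Module.annihilator (MonoidAlgebra ℂ Γ) (MonoidAlgebra ℂ Γ) := by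
    rw [← Submodule.annihilator_top,
      ← IsSemisimpleModule.sSup_simples_eq_top (MonoidAlgebra ℂ Γ) (MonoidAlgebra ℂ Γ),
      sSup_eq_iSup', Submodule.annihilator_iSup, Submodule.mem_iInf]
    rintro ⟨m, hm⟩
    have hm' : IsSimpleModule (MonoidAlgebra ℂ Γ) m := hm
    have : Module.Finite ℂ m :=
      inferInstanceAs (Module.Finite ℂ (m.restrictScalars ℂ))
    have h := ha _ (FDRep.simple_of_isSimpleModule m)
    rw [Submodule.mem_annihilator]
    intro v hv
    have h1 := LinearMap.congr_fun h (⟨v, hv⟩ : m)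
    rw [LinearMap.sum_apply] at h1
    have h2 : ∑ γ, a γ • ((MonoidAlgebra.single γ (1 : ℂ)) • (⟨v, hv⟩ : m)) = 0 := h1
    have h3 : ∑ γ, a γ • (MonoidAlgebra.single γ (1 : ℂ) • v) = 0 := by
      simpa using congrArg Subtype.val h2
    rw [Finset.sum_smul, ← h3]
    refine Finset.sum_congr rfl fun γ _ => ?_
    rw [← smul_assoc, MonoidAlgebra.smul_single, smul_eq_mul (a γ), mul_one, smul_eq_mul]
  have hx0 : x = 0 := by
    simpa using Module.mem_annihilator.mp hx 1
  funext γ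
  have := congrArg (fun y : MonoidAlgebra ℂ Γ => y.coeff γ) hx0
  simpa [x, MonoidAlgebra.coeff_single, Finsupp.single_apply] using this
/-- The matrix form of a finite-dimensional representation. -/
def FDRep.matrixRep {Γ : Type} [Group Γ] (V : FDRep ℂ Γ) :
    Γ →* Matrix (Fin (Module.finrank ℂ V)) (Fin (Module.finrank ℂ V)) ℂ :=
  (LinearMap.toMatrixAlgEquiv (Module.finBasis ℂ V)).toMulEquiv.toMonoidHom.comp V.ρ

lemma FDRep.matrixRep_apply {Γ : Type} [Group Γ] (V : FDRep ℂ Γ) (γ : Γ) :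
    V.matrixRep γ = LinearMap.toMatrix (Module.finBasis ℂ V) (Module.finBasis ℂ V) (V.ρ γ) := rfl

lemma FDRep.toMatrix_average {Γ : Type} [Group Γ] [Fintype Γ] (V W : FDRep ℂ Γ)
    (X : Matrix (Fin (Module.finrank ℂ W)) (Fin (Module.finrank ℂ V)) ℂ) :
    LinearMap.toMatrix (Module.finBasis ℂ V) (Module.finBasis ℂ W)
      (∑ γ, W.ρ γ ∘ₗ Matrix.toLin (Module.finBasis ℂ V) (Module.finBasis ℂ W) X ∘ₗ V.ρ γ⁻¹) =
      ∑ γ, W.matrixRep γ * X * V.matrixRep γ⁻¹ := by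
  rw [map_sum]
  refine Finset.sum_congr rfl fun γ _ => ?_
  rw [LinearMap.toMatrix_comp _ (Module.finBasis ℂ W), LinearMap.toMatrix_comp _ (Module.finBasis ℂ V),
    LinearMap.toMatrix_toLin, Matrix.mul_assoc, matrixRep_apply, matrixRep_apply]

lemma Matrix.mul_single_mul_apply {l m n o : Type*} [Fintype m] [Fintype n] [DecidableEq m]
    [DecidableEq n] (A : Matrix l m ℂ) (B : Matrix n o ℂ) (i : m) (j : n) (p : l) (q : o) :
    (A * Matrix.single i j (1 : ℂ) * B) p q = A p i * B j q := by
  simp [Matrix.mul_apply, Matrix.single_apply, ite_and]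

lemma FDRep.sum_matrixRep_mul_eq_zero {Γ : Type} [Group Γ] [Fintype Γ] (V W : FDRep ℂ Γ)
    [Simple V] [Simple W] (h : ¬ Nonempty (V ≅ W)) (p i : Fin (Module.finrank ℂ W))
    (j q : Fin (Module.finrank ℂ V)) :
    ∑ γ, W.matrixRep γ p i * V.matrixRep γ⁻¹ j q = 0 := by
  have h0 := FDRep.toMatrix_average V W (Matrix.single i j 1)
  rw [FDRep.average_eq_zero V W h, map_zero] at h0
  have h1 := congrFun (congrFun h0 p) q
  simpa [Matrix.sum_apply, Matrix.mul_single_mul_apply] using h1.symm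

lemma FDRep.sum_matrixRep_mul {Γ : Type} [Group Γ] [Fintype Γ] (V : FDRep ℂ Γ) [Simple V]
    (p i j q : Fin (Module.finrank ℂ V)) :
    ∑ γ, V.matrixRep γ p i * V.matrixRep γ⁻¹ j q =
      if i = j ∧ p = q then (Fintype.card Γ : ℂ) / Module.finrank ℂ V else 0 := by
  obtain ⟨c, hc⟩ := V.exists_average_eq_smul
    (Matrix.toLin (Module.finBasis ℂ V) (Module.finBasis ℂ V) (Matrix.single i j 1))
  have h0 := FDRep.toMatrix_average V V (Matrix.single i j 1)
  rw [hc, map_smul, LinearMap.toMatrix_id] at h0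
  have hn : (Module.finrank ℂ V : ℂ) ≠ 0 := by
    have := p.pos
    exact_mod_cast this.ne'
  have htr := congrArg Matrix.trace h0
  have hterm : ∀ γ : Γ, (V.matrixRep γ * Matrix.single i j (1 : ℂ) * V.matrixRep γ⁻¹).trace =
      if i = j then 1 else 0 := fun γ => by
    rw [Matrix.trace_mul_comm, ← Matrix.mul_assoc, ← map_mul, inv_mul_cancel, map_one,
      Matrix.one_mul]
    split_ifs with hij
    · subst hij
      simp
    · exact Matrix.trace_single_eq_of_ne i j 1 hij
  rw [Matrix.trace_sum, Finset.sum_congr rfl fun γ _ => hterm γ] at htr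
  simp only [Matrix.trace_smul, Matrix.trace_one, Fintype.card_fin, smul_eq_mul,
    Finset.sum_const, Finset.card_univ, nsmul_eq_mul] at htr
  have h1 := congrFun (congrFun h0 p) q
  simp only [Matrix.sum_apply, Matrix.mul_single_mul_apply, Matrix.smul_apply, Matrix.one_apply,
    smul_eq_mul] at h1
  rw [← h1]
  by_cases hpq : p = q <;> by_cases hij : i = j <;> simp only [hpq, hij, if_true, if_false,
    and_true, and_false, mul_one, mul_zero] at htr ⊢
  · rw [← htr, mul_div_cancel_right₀ _ hn]
  · exact (mul_eq_zero.mp htr).resolve_right hn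

/-- The direct sum of a family of representations, in block diagonal matrix form. -/
def blockRep {Γ R : Type} [Group Γ] [Fintype R] [DecidableEq R] (Ψ : R → FDRep ℂ Γ) :
    Γ →* Matrix (Σ r, Fin (Module.finrank ℂ (Ψ r))) (Σ r, Fin (Module.finrank ℂ (Ψ r))) ℂ where
  toFun γ := Matrix.blockDiagonal' fun r => (Ψ r).matrixRep γ
  map_one' := by
    simp only [map_one]
    exact Matrix.blockDiagonal'_one
  map_mul' γ δ := by
    simp only [map_mul]
    exact Matrix.blockDiagonal'_mul _ _

lemma blockRep_apply_eq {Γ R : Type} [Group Γ] [Fintype R] [DecidableEq R] (Ψ : R → FDRep ℂ Γ)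
    (γ : Γ) (r : R) (i j : Fin (Module.finrank ℂ (Ψ r))) :
    blockRep Ψ γ ⟨r, i⟩ ⟨r, j⟩ = (Ψ r).matrixRep γ i j :=
  Matrix.blockDiagonal'_apply_eq (fun r => (Ψ r).matrixRep γ) r i j

lemma blockRep_apply_ne {Γ R : Type} [Group Γ] [Fintype R] [DecidableEq R] (Ψ : R → FDRep ℂ Γ)
    (γ : Γ) (p q : Σ r, Fin (Module.finrank ℂ (Ψ r))) (h : p.1 ≠ q.1) :
    blockRep Ψ γ p q = 0 :=
  Matrix.blockDiagonal'_apply_ne (fun r => (Ψ r).matrixRep γ) p.2 q.2 h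

lemma sum_smul_blockRep_eq_single {Γ R : Type} [Group Γ] [Fintype Γ] [Fintype R] [DecidableEq R]
    (Ψ : R → FDRep ℂ Γ) (hsimple : ∀ r, Simple (Ψ r))
    (hdistinct : ∀ r r' : R, Nonempty (Ψ r ≅ Ψ r') → r = r') (r : R)
    (i j : Fin (Module.finrank ℂ (Ψ r))) :
    ∑ γ, ((Module.finrank ℂ (Ψ r) : ℂ) / Fintype.card Γ * (Ψ r).matrixRep γ⁻¹ j i) •
      blockRep Ψ γ = Matrix.single ⟨r, i⟩ ⟨r, j⟩ 1 := by
  have hn : (Module.finrank ℂ (Ψ r) : ℂ) ≠ 0 := by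
    have := i.pos
    exact_mod_cast this.ne'
  have hc : (Fintype.card Γ : ℂ) ≠ 0 := Nat.cast_ne_zero.mpr Fintype.card_ne_zero
  ext ⟨s, k⟩ ⟨t, l⟩
  simp only [Matrix.sum_apply, Matrix.smul_apply, smul_eq_mul, Matrix.single_apply]
  by_cases hst : s = t
  · subst hst
    simp only [blockRep_apply_eq, mul_assoc, ← Finset.mul_sum]
    simp only [mul_comm ((Ψ r).matrixRep _ j i)]
    by_cases hrs : r = s
    · subst hrs
      rw [FDRep.sum_matrixRep_mul]
      simp only [Sigma.mk.injEq, heq_eq_eq, true_and]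
      by_cases h : i = k ∧ j = l
      · obtain ⟨rfl, rfl⟩ := h
        simp only [and_self, if_true]
        field_simp
      · rw [if_neg h, if_neg fun h' => h ⟨h'.2.symm, h'.1.symm⟩, mul_zero]
    · rw [FDRep.sum_matrixRep_mul_eq_zero _ _ fun h => hrs (hdistinct r s h)]
      simp [hrs]
  · rw [Finset.sum_eq_zero fun γ _ => by rw [blockRep_apply_ne Ψ γ _ _ hst, mul_zero], if_neg]
    rintro ⟨h1, h2⟩
    exact hst ((congrArg Sigma.fst h1).symm.trans (congrArg Sigma.fst h2))

/-- Column orthogonality: the regular character is the sum of the irreducible characters, weighted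
by their degrees. -/
lemma sum_finrank_mul_trace_matrixRep {Γ R : Type} [Group Γ] [DecidableEq Γ] [Fintype Γ]
    [Fintype R] [DecidableEq R]
    (Ψ : R → FDRep ℂ Γ) (hsimple : ∀ r, Simple (Ψ r))
    (hdistinct : ∀ r r' : R, Nonempty (Ψ r ≅ Ψ r') → r = r')
    (hcomplete : ∀ τ : FDRep ℂ Γ, Simple τ → ∃ r, Nonempty (τ ≅ Ψ r)) (γ : Γ) :
    ∑ r, (Module.finrank ℂ (Ψ r) : ℂ) * ((Ψ r).matrixRep γ).trace =
      if γ = 1 then (Fintype.card Γ : ℂ) else 0 := by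
  have hc : (Fintype.card Γ : ℂ) ≠ 0 := Nat.cast_ne_zero.mpr Fintype.card_ne_zero
  let b : Γ → ℂ := fun γ => ∑ r, ∑ i, (Module.finrank ℂ (Ψ r) : ℂ) / Fintype.card Γ *
    (Ψ r).matrixRep γ⁻¹ i i
  have hb : ∑ γ, b γ • blockRep Ψ γ = 1 := by
    simp only [b, Finset.sum_smul]
    rw [Finset.sum_comm]
    simp only [Finset.sum_comm (s := (Finset.univ : Finset Γ)),
      sum_smul_blockRep_eq_single Ψ hsimple hdistinct]
    rw [← Fintype.sum_sigma fun p : Σ r, Fin (Module.finrank ℂ (Ψ r)) => Matrix.single p p (1 : ℂ)]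
    exact Matrix.sum_single_one
  have ha := eq_zero_of_forall_simple (fun γ => b γ - if γ = 1 then 1 else 0) fun V hV => by
    obtain ⟨s, ⟨e⟩⟩ := hcomplete V hV
    have hs : ∑ γ, (b γ - if γ = 1 then 1 else 0) • (Ψ s).ρ γ = 0 := by
      apply (LinearMap.toMatrix (Module.finBasis ℂ (Ψ s)) (Module.finBasis ℂ (Ψ s))).injective
      rw [map_zero, map_sum]
      simp only [map_smul, ← FDRep.matrixRep_apply]
      ext i j
      have := congrFun (congrFun hb ⟨s, i⟩) ⟨s, j⟩
      simp only [Matrix.sum_apply, Matrix.smul_apply, blockRep_apply_eq, smul_eq_mul,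
        Matrix.one_apply] at this
      simp [Matrix.sum_apply, sub_mul, this, Matrix.one_apply]
    have hconj : ∀ γ, V.ρ γ = (FDRep.isoToLinearEquiv e).symm.conj ((Ψ s).ρ γ) := fun γ =>
      FDRep.Iso.conj_ρ e.symm γ
    simp only [hconj, ← map_smul, ← map_sum, hs, map_zero]
  have hγ := congrFun ha γ⁻¹
  simp only [Pi.zero_apply, b, inv_inv, inv_eq_one, sub_eq_zero, ← Finset.mul_sum] at hγ
  have : (Fintype.card Γ : ℂ) * (if γ = 1 then 1 else 0) = if γ = 1 then (Fintype.card Γ : ℂ) else 0 := by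
    simp
  rw [← this, ← hγ, Finset.mul_sum]
  refine Finset.sum_congr rfl fun r _ => ?_
  rw [Matrix.trace]
  simp only [Matrix.diag]
  field_simp
lemma trace_diagProj_blockRep {Γ R : Type} [Group Γ] [Fintype Γ] [Fintype R] [DecidableEq R]
    (Ψ : R → FDRep ℂ Γ) (n : ℕ) (τ : Fin n → R) :
    (diagProj (blockRep Ψ) n * blockProj Sigma.fst τ).trace =
      (Fintype.card Γ : ℂ)⁻¹ * ∑ γ, ∏ t, ((Ψ (τ t)).matrixRep γ).trace := by
  rw [trace_diagProj_mul_blockProj]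
  congr 1
  refine Finset.sum_congr rfl fun γ _ => Finset.prod_congr rfl fun t _ => ?_
  rw [Fintype.sum_sigma, Finset.sum_eq_single (τ t) (fun r _ hr => by simp [hr]) (by simp)]
  simp [blockRep_apply_eq, Matrix.trace]

/-- If `(G_3, K_3)` is a Gelfand pair, then `(dim π)² ≤ 4 dim π + ∑_{ψ ≠ π} 2 dim ψ` for every
irreducible representation `π` of `Γ`. -/
lemma IsGelfandPair.finrank_sq_le {Γ R : Type} [Group Γ] [DecidableEq Γ] [Fintype Γ] [Fintype R]
    [DecidableEq R] (h : IsGelfandPair (Gn Γ 3) (Kn Γ 3))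
    (Ψ : R → FDRep ℂ Γ) (hsimple : ∀ r, Simple (Ψ r))
    (hdistinct : ∀ r r' : R, Nonempty (Ψ r ≅ Ψ r') → r = r')
    (hcomplete : ∀ τ : FDRep ℂ Γ, Simple τ → ∃ r, Nonempty (τ ≅ Ψ r)) (r₀ : R) :
    Module.finrank ℂ (Ψ r₀) ^ 2 ≤ 4 * Module.finrank ℂ (Ψ r₀) +
      ∑ r ∈ Finset.univ.erase r₀, 2 * Module.finrank ℂ (Ψ r) := by
  have hc : (Fintype.card Γ : ℂ) ≠ 0 := Nat.cast_ne_zero.mpr Fintype.card_ne_zero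
  have hblock := blockRep_apply_ne Ψ
  have hunit : ∀ p q : Σ r, Fin (Module.finrank ℂ (Ψ r)), p.1 = q.1 →
      ∃ a : Γ → ℂ, ∑ γ, a γ • blockRep Ψ γ = Matrix.single p q 1 := by
    rintro ⟨r, i⟩ ⟨s, j⟩ hrs
    obtain rfl : r = s := hrs
    exact ⟨_, sum_smul_blockRep_eq_single Ψ hsimple hdistinct r i j⟩
  let m : R → ℂ := fun r => (diagProj (blockRep Ψ) 3 * blockProj Sigma.fst ![r₀, r₀, r]).trace
  have hm : (Module.finrank ℂ (Ψ r₀) : ℂ) ^ 2 = ∑ r, (Module.finrank ℂ (Ψ r) : ℂ) * m r := by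
    have hmr : ∀ r, m r = (Fintype.card Γ : ℂ)⁻¹ *
        ∑ γ, ((Ψ r₀).matrixRep γ).trace ^ 2 * ((Ψ r).matrixRep γ).trace := fun r => by
      simp only [m, trace_diagProj_blockRep, Fin.prod_univ_three, sq]
      rfl
    have hswap : ∑ r, (Module.finrank ℂ (Ψ r) : ℂ) * m r = (Fintype.card Γ : ℂ)⁻¹ *
        ∑ γ, ((Ψ r₀).matrixRep γ).trace ^ 2 *
          ∑ r, (Module.finrank ℂ (Ψ r) : ℂ) * ((Ψ r).matrixRep γ).trace := by
      simp only [hmr, Finset.mul_sum]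
      rw [Finset.sum_comm]
      refine Finset.sum_congr rfl fun γ _ => Finset.sum_congr rfl fun r _ => by ring
    rw [hswap]
    simp only [sum_finrank_mul_trace_matrixRep Ψ hsimple hdistinct hcomplete]
    simp
    field_simp
  have hbound : ((Module.finrank ℂ (Ψ r₀) ^ 2 : ℕ) : ℝ) ≤ (4 * Module.finrank ℂ (Ψ r₀) +
      ∑ r ∈ Finset.univ.erase r₀, 2 * Module.finrank ℂ (Ψ r) : ℕ) := by
    calc ((Module.finrank ℂ (Ψ r₀) ^ 2 : ℕ) : ℝ)
        = ‖∑ r, (Module.finrank ℂ (Ψ r) : ℂ) * m r‖ := by rw [← hm]; simp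
      _ ≤ ∑ r, ‖(Module.finrank ℂ (Ψ r) : ℂ) * m r‖ := norm_sum_le _ _
      _ = ‖(Module.finrank ℂ (Ψ r₀) : ℂ) * m r₀‖ +
          ∑ r ∈ Finset.univ.erase r₀, ‖(Module.finrank ℂ (Ψ r) : ℂ) * m r‖ :=
        (Finset.add_sum_erase _ _ (Finset.mem_univ r₀)).symm
      _ ≤ Module.finrank ℂ (Ψ r₀) * 4 +
          ∑ r ∈ Finset.univ.erase r₀, (Module.finrank ℂ (Ψ r) * 2 : ℝ) := by
        gcongr with r hr
        · rw [norm_mul, Complex.norm_natCast]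
          exact mul_le_mul_of_nonneg_left (h.norm_le_four _ _ hblock hunit r₀) (Nat.cast_nonneg _)
        · rw [norm_mul, Complex.norm_natCast]
          exact mul_le_mul_of_nonneg_left
            (h.norm_le_two _ _ hblock hunit (Finset.ne_of_mem_erase hr)) (Nat.cast_nonneg _)
      _ = _ := by
        push_cast
        simp only [mul_comm]
  exact_mod_cast hbound

attribute [local instance] Classical.propDecidable

/-- If `π_m` is an irreducible representation of `S_k` of maximal dimension with
`(dim π_m)² > 4 dim π_m + Σ_{ψ ≠ π_m} 2 dim ψ` (the sum over a complete family `{Ψ_r}` of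
pairwise non-isomorphic irreducible representations of `S_k`, `Ψ_{r₀} ≅ π_m`), then for
`Γ = S_k` the pair `(G_3, K_3)` is not a Gelfand pair. -/
theorem not_isGelfandPair_three_of_dim_sq_gt (k : ℕ) (hk : 1 ≤ k)
    (πm : FDRep ℂ (Equiv.Perm (Fin k))) (hsimple : Simple πm)
    (hmax : ∀ ψ : FDRep ℂ (Equiv.Perm (Fin k)), Simple ψ →
      Module.finrank ℂ ψ ≤ Module.finrank ℂ πm)
    (R : Type) [Fintype R] (Ψ : R → FDRep ℂ (Equiv.Perm (Fin k)))
    (hΨsimple : ∀ r, Simple (Ψ r))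
    (hΨdistinct : ∀ r r' : R, Nonempty (Ψ r ≅ Ψ r') → r = r')
    (hΨcomplete : ∀ τ : FDRep ℂ (Equiv.Perm (Fin k)), Simple τ → ∃ r, Nonempty (τ ≅ Ψ r))
    (r₀ : R) (hr₀ : Nonempty (Ψ r₀ ≅ πm))
    (hgt : 4 * Module.finrank ℂ πm +
        ∑ r ∈ Finset.univ.erase r₀, 2 * Module.finrank ℂ (Ψ r) <
      (Module.finrank ℂ πm) ^ 2) :
    ¬ IsGelfandPair (Gn (Equiv.Perm (Fin k)) 3) (Kn (Equiv.Perm (Fin k)) 3) := by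
  obtain ⟨e⟩ := hr₀
  have hfin : Module.finrank ℂ (Ψ r₀) = Module.finrank ℂ πm :=
    (FDRep.isoToLinearEquiv e).finrank_eq
  intro h
  refine absurd ?_ hgt.not_ge
  rw [← hfin]
  exact IsGelfandPair.finrank_sq_le (by convert h) Ψ hΨsimple hΨdistinct hΨcomplete r₀
end
end

section
/- Let Γ = S_4 and let std be its standard 3-dimensional irreducible representation (the action of S_4 on {x ∈ ℂ⁴ : x_1+x_2+x_3+x_4 = 0}). Let π = std ⊗̂ std ⊗̂ std ⊗̂ std, an irreducible representation of (S_4)⁴ whose stabilizer in S_4 (acting by permuting the factors) is S_π = S_4. Then there exists an irreducible representation ρ of S_π such that ⟨M_π, χ_ρ⟩_{S_π} ≥ 2; consequently (G_4, K_4) is not a Gelfand pair for Γ = S_4. -/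
noncomputable section

open CategoryTheory
open scoped TensorProduct MonoidalCategory

open scoped TensorProduct MonoidalCategory

/-- The stabilizer `S_π ⊆ S_n` of the labelled family `π_{ℓ1} ⊗̂ ⋯ ⊗̂ π_{ℓn}`, i.e. the
subgroup of permutations fixing the labelling function `ℓ`. -/
def stab {n : ℕ} {S : Type} (ℓ : Fin n → S) : Subgroup (Equiv.Perm (Fin n)) where
  carrier := {σ | ∀ i, ℓ (σ i) = ℓ i}
  one_mem' := fun _ => rfl
  mul_mem' := by
    intro a b ha hb i
    simpa [Equiv.Perm.mul_apply, hb i] using ha (b i)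
  inv_mem' := by
    intro a ha i
    simpa using (ha (a⁻¹ i)).symm

/-- Transport along an equality of labels. -/
def castLEquiv {Γ S : Type} [Group Γ] (π : S → FDRep ℂ Γ) {s t : S} (h : s = t) :
    (π s : Type) ≃ₗ[ℂ] (π t : Type) := by
  subst h; exact LinearEquiv.refl ℂ (π s)

/-- The intertwining operator `ω(σ)` on `V_1 ⊗ ⋯ ⊗ V_n`, sending
`v_1 ⊗ ⋯ ⊗ v_n` to `v_{σ⁻¹(1)} ⊗ ⋯ ⊗ v_{σ⁻¹(n)}`. -/
def permOp {Γ S : Type} [Group Γ] {n : ℕ} (π : S → FDRep ℂ Γ) (ℓ : Fin n → S)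
    (σ : stab ℓ) : (⨂[ℂ] i, (π (ℓ i) : Type)) →ₗ[ℂ] ⨂[ℂ] i, (π (ℓ i) : Type) :=
  ((PiTensorProduct.reindex ℂ (fun i => (π (ℓ i) : Type)) (σ : Equiv.Perm (Fin n))).trans
    (PiTensorProduct.congr fun i =>
      castLEquiv π (((stab ℓ).inv_mem σ.2) i))).toLinearMap

/-- The character `χ_{π∘ω}` of the representation `π ∘ ω` of `Γ^n ⋊ S_π` on
`V_1 ⊗ ⋯ ⊗ V_n`, given by `(g, σ) ↦ trace (π(g) ∘ ω(σ))`. -/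
def chiPiOmega {Γ S : Type} [Group Γ] {n : ℕ} (π : S → FDRep ℂ Γ) (ℓ : Fin n → S)
    (g : Fin n → Γ) (σ : stab ℓ) : ℂ :=
  LinearMap.trace ℂ _
    ((PiTensorProduct.map fun i => (π (ℓ i)).ρ (g i)) ∘ₗ permOp π ℓ σ)

/-- The class function `M_π` on `S_π`:
`M_π(σ) = (1/|Δ_n|) Σ_{δ ∈ Δ_n} χ_{π∘ω}(δ, σ)`, where `Δ_n ≃ Γ` is the diagonal. -/
def Mpi {Γ S : Type} [Group Γ] [Fintype Γ] {n : ℕ} (π : S → FDRep ℂ Γ) (ℓ : Fin n → S)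
    (σ : stab ℓ) : ℂ :=
  (Fintype.card Γ : ℂ)⁻¹ * ∑ γ : Γ, chiPiOmega π ℓ (fun _ => γ) σ

attribute [local instance] Classical.propDecidable

/-- The linear functional `x ↦ x 0 + x 1 + x 2 + x 3` on `ℂ⁴`. -/
def sumFunctional : (Fin 4 → ℂ) →ₗ[ℂ] ℂ := ∑ i : Fin 4, LinearMap.proj i

/-- The subspace `{x ∈ ℂ⁴ : x 0 + x 1 + x 2 + x 3 = 0}`. -/
def zeroSum : Submodule ℂ (Fin 4 → ℂ) := LinearMap.ker sumFunctional

/-- The permutation representation of `S_4` on `ℂ⁴`. -/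
def permRep4 : Representation ℂ (Equiv.Perm (Fin 4)) (Fin 4 → ℂ) where
  toFun σ := LinearMap.funLeft ℂ ℂ σ.symm
  map_one' := by ext x i; rfl
  map_mul' := fun σ τ => by ext x i; rfl

lemma zeroSum_invariant (σ : Equiv.Perm (Fin 4)) :
    ∀ x ∈ zeroSum, permRep4 σ x ∈ zeroSum := by
  intro x hx
  simp only [zeroSum, LinearMap.mem_ker, sumFunctional, LinearMap.sum_apply,
    LinearMap.proj_apply] at hx ⊢
  simpa [permRep4, LinearMap.funLeft] using
    (Equiv.sum_comp σ.symm x).trans hx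

/-- The standard 3-dimensional representation of `S_4`: the action of `S_4` on
`{x ∈ ℂ⁴ : x 0 + x 1 + x 2 + x 3 = 0}`. -/
def stdRep : Representation ℂ (Equiv.Perm (Fin 4)) zeroSum where
  toFun σ := (permRep4 σ).restrict (zeroSum_invariant σ)
  map_one' := by ext x; rfl
  map_mul' := fun σ τ => by ext x; rfl

/-- The standard representation of `S_4` as an object of `FDRep ℂ S_4`. -/
def stdFDRep : FDRep ℂ (Equiv.Perm (Fin 4)) := FDRep.of stdRep

section Combinatorics

/-- The underlying maps of all permutations of `Fin 4`. -/
def permList : List (Fin 4 → Fin 4) :=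
  [![0, 1, 2, 3], ![0, 1, 3, 2], ![0, 2, 1, 3], ![0, 2, 3, 1],
   ![0, 3, 1, 2], ![0, 3, 2, 1], ![1, 0, 2, 3], ![1, 0, 3, 2],
   ![1, 2, 0, 3], ![1, 2, 3, 0], ![1, 3, 0, 2], ![1, 3, 2, 0],
   ![2, 0, 1, 3], ![2, 0, 3, 1], ![2, 1, 0, 3], ![2, 1, 3, 0],
   ![2, 3, 0, 1], ![2, 3, 1, 0], ![3, 0, 1, 2], ![3, 0, 2, 1],
   ![3, 1, 0, 2], ![3, 1, 2, 0], ![3, 2, 0, 1], ![3, 2, 1, 0]]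

lemma univ_perm_map_coe :
    (Finset.univ : Finset (Equiv.Perm (Fin 4))).val.map
      (fun γ : Equiv.Perm (Fin 4) => (γ : Fin 4 → Fin 4)) = ↑permList := by
  decide +kernel

lemma sum_perm_eq_list_sum {M : Type*} [AddCommMonoid M] (F : (Fin 4 → Fin 4) → M) :
    ∑ γ : Equiv.Perm (Fin 4), F γ = (permList.map F).sum := by
  have h := congrArg (fun s => (Multiset.map F s).sum) univ_perm_map_coe
  simp only [Multiset.map_map, Multiset.map_coe, Multiset.sum_coe] at h
  exact h

/-- The integer matrix of the linear extension of `e_j ↦ e_{g j}` to `zeroSum`, with respect to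
the basis `e_j - e_3`. -/
def stdEntry (g : Fin 4 → Fin 4) (i j : Fin 3) : ℤ :=
  (if g j.castSucc = i.castSucc then 1 else 0) - (if g 3 = i.castSucc then 1 else 0)

/-- The trace of `A^{⊗4}` composed with the permutation of the factors given by `σ`. -/
def tensorTrace (A : Fin 3 → Fin 3 → ℤ) (σ : Equiv.Perm (Fin 4)) : ℤ :=
  ∑ f : Fin 4 → Fin 3, ∏ i, A (f i) (f (σ i))

lemma tensorTrace_conj (A : Fin 3 → Fin 3 → ℤ) (σ τ : Equiv.Perm (Fin 4)) :
    tensorTrace A (τ * σ * τ⁻¹) = tensorTrace A σ := by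
  unfold tensorTrace
  rw [← Equiv.sum_comp (Equiv.arrowCongr τ (Equiv.refl (Fin 3)))]
  refine Finset.sum_congr rfl fun f _ => ?_
  rw [← Equiv.prod_comp τ]
  simp [Equiv.arrowCongr]

lemma sum_fun_four {M : Type*} [AddCommMonoid M] (F : (Fin 4 → Fin 3) → M) :
    ∑ f, F f = ∑ a, ∑ b, ∑ c, ∑ d, F ![a, b, c, d] := by
  simp_rw [← Fintype.sum_prod_type']
  symm
  refine Fintype.sum_bijective
    (fun x : Fin 3 × Fin 3 × Fin 3 × Fin 3 => ![x.1, x.2.1, x.2.2.1, x.2.2.2]) ?_ _ _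
    (fun _ => rfl)
  decide +kernel

/-- A representative of the conjugacy class of `σ`. -/
def conjRep (σ : Equiv.Perm (Fin 4)) : Equiv.Perm (Fin 4) :=
  if σ = 1 then 1
  else if σ ^ 2 = 1 then
    if ∃ i, σ i = i then Equiv.swap 0 1 else Equiv.swap 0 1 * Equiv.swap 2 3
  else if σ ^ 3 = 1 then Equiv.swap 0 1 * Equiv.swap 1 2
  else Equiv.swap 0 1 * Equiv.swap 1 2 * Equiv.swap 2 3

lemma exists_conj_conjRep : ∀ σ : Equiv.Perm (Fin 4), ∃ τ : Equiv.Perm (Fin 4),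
    τ * conjRep σ * τ⁻¹ = σ := by
  decide +kernel

lemma univ_perm_map_conjRep :
    (Finset.univ : Finset (Equiv.Perm (Fin 4))).val.map conjRep =
      Multiset.replicate 1 1 + Multiset.replicate 6 (Equiv.swap 0 1) +
      Multiset.replicate 3 (Equiv.swap 0 1 * Equiv.swap 2 3) +
      Multiset.replicate 8 (Equiv.swap 0 1 * Equiv.swap 1 2) +
      Multiset.replicate 6 (Equiv.swap 0 1 * Equiv.swap 1 2 * Equiv.swap 2 3) := by
  decide +kernel

lemma sum_tensorTrace (A : Fin 3 → Fin 3 → ℤ) :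
    ∑ σ, tensorTrace A σ = tensorTrace A 1 + 6 * tensorTrace A (Equiv.swap 0 1) +
      3 * tensorTrace A (Equiv.swap 0 1 * Equiv.swap 2 3) +
      8 * tensorTrace A (Equiv.swap 0 1 * Equiv.swap 1 2) +
      6 * tensorTrace A (Equiv.swap 0 1 * Equiv.swap 1 2 * Equiv.swap 2 3) := by
  have h1 : ∀ σ, tensorTrace A σ = tensorTrace A (conjRep σ) := fun σ => by
    obtain ⟨τ, hτ⟩ := exists_conj_conjRep σ
    conv_lhs => rw [← hτ, tensorTrace_conj]
  have h := congrArg (fun s => (Multiset.map (tensorTrace A) s).sum) univ_perm_map_conjRep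
  simp only [Multiset.map_add, Multiset.sum_add, Multiset.map_replicate,
    Multiset.sum_replicate, Multiset.map_map, nsmul_eq_mul] at h
  rw [Finset.sum_congr rfl fun σ _ => h1 σ]
  refine h.trans ?_
  norm_num

lemma tensorTrace_eq (A : Fin 3 → Fin 3 → ℤ) (σ : Equiv.Perm (Fin 4)) {s₀ s₁ s₂ s₃ : Fin 4}
    (h : ⇑σ = ![s₀, s₁, s₂, s₃]) :
    tensorTrace A σ = ∑ a, ∑ b, ∑ c, ∑ d, A a (![a, b, c, d] s₀) * A b (![a, b, c, d] s₁) *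
      A c (![a, b, c, d] s₂) * A d (![a, b, c, d] s₃) := by
  rw [tensorTrace, sum_fun_four]
  simp only [Fin.prod_univ_four, h]
  rfl

lemma sum_tensorTrace_one :
    ∑ γ : Equiv.Perm (Fin 4), tensorTrace (stdEntry γ) 1 = 96 := by
  rw [sum_perm_eq_list_sum fun g => tensorTrace (stdEntry g) 1]
  simp_rw [tensorTrace_eq _ (1 : Equiv.Perm (Fin 4))
    (by decide : _ = ![(0 : Fin 4), 1, 2, 3])]
  decide +kernel

lemma sum_tensorTrace_swap :
    ∑ γ : Equiv.Perm (Fin 4), tensorTrace (stdEntry γ) (Equiv.swap 0 1) = 48 := by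
  rw [sum_perm_eq_list_sum fun g => tensorTrace (stdEntry g) (Equiv.swap 0 1)]
  simp_rw [tensorTrace_eq _ (Equiv.swap (0 : Fin 4) 1)
    (by decide : _ = ![(1 : Fin 4), 0, 2, 3])]
  decide +kernel

lemma sum_tensorTrace_swap_mul_swap :
    ∑ γ : Equiv.Perm (Fin 4),
      tensorTrace (stdEntry γ) (Equiv.swap 0 1 * Equiv.swap 2 3) = 96 := by
  rw [sum_perm_eq_list_sum fun g =>
    tensorTrace (stdEntry g) (Equiv.swap 0 1 * Equiv.swap 2 3)]
  simp_rw [tensorTrace_eq _ (Equiv.swap (0 : Fin 4) 1 * Equiv.swap 2 3)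
    (by decide : _ = ![(1 : Fin 4), 0, 3, 2])]
  decide +kernel

lemma sum_tensorTrace_threeCycle :
    ∑ γ : Equiv.Perm (Fin 4),
      tensorTrace (stdEntry γ) (Equiv.swap 0 1 * Equiv.swap 1 2) = 24 := by
  rw [sum_perm_eq_list_sum fun g =>
    tensorTrace (stdEntry g) (Equiv.swap 0 1 * Equiv.swap 1 2)]
  simp_rw [tensorTrace_eq _ (Equiv.swap (0 : Fin 4) 1 * Equiv.swap 1 2)
    (by decide : _ = ![(1 : Fin 4), 2, 0, 3])]
  decide +kernel

lemma sum_tensorTrace_fourCycle :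
    ∑ γ : Equiv.Perm (Fin 4),
      tensorTrace (stdEntry γ) (Equiv.swap 0 1 * Equiv.swap 1 2 * Equiv.swap 2 3) = 48 := by
  rw [sum_perm_eq_list_sum fun g =>
    tensorTrace (stdEntry g) (Equiv.swap 0 1 * Equiv.swap 1 2 * Equiv.swap 2 3)]
  simp_rw [tensorTrace_eq _ (Equiv.swap (0 : Fin 4) 1 * Equiv.swap 1 2 * Equiv.swap 2 3)
    (by decide : _ = ![(1 : Fin 4), 2, 3, 0])]
  decide +kernel

lemma sum_sum_tensorTrace_stdEntry :
    ∑ σ, ∑ γ : Equiv.Perm (Fin 4), tensorTrace (stdEntry γ) σ = 1152 := by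
  rw [Finset.sum_comm]
  simp_rw [sum_tensorTrace, Finset.sum_add_distrib, ← Finset.mul_sum, sum_tensorTrace_one,
    sum_tensorTrace_swap, sum_tensorTrace_swap_mul_swap, sum_tensorTrace_threeCycle,
    sum_tensorTrace_fourCycle]
  norm_num

/-- Four times the orthogonal projection of `ℂ⁴` onto `zeroSum`, as an integer matrix. -/
def projEntry (k l : Fin 4) : ℤ := if k = l then 3 else -1

lemma projEntry_perm (a : Equiv.Perm (Fin 4)) (k l : Fin 4) :
    projEntry (a k) (a l) = projEntry k l := by
  simp [projEntry]

lemma projEntry_apply_inv (a : Equiv.Perm (Fin 4)) (k l : Fin 4) :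
    projEntry k (a l) = projEntry (a⁻¹ k) l := by
  rw [← projEntry_perm a (a⁻¹ k) l]
  simp

/-- Schur orthogonality for the standard representation. -/
lemma sum_projEntry_mul_projEntry (k l k' l' : Fin 4) :
    ∑ b : Equiv.Perm (Fin 4), projEntry (b k) l * projEntry k' (b l') =
      8 * (projEntry k l' * projEntry k' l) := by
  rw [sum_perm_eq_list_sum fun b => projEntry (b k) l * projEntry k' (b l')]
  revert k l k' l'
  decide +kernel

/-- The matrix coefficient of `std^{⊗4}` attached to two tensors with coordinates `w`, `w'`. -/
def matrixCoeff (w w' : (Fin 4 → Fin 4) → ℤ) (a : Fin 4 → Equiv.Perm (Fin 4)) : ℤ :=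
  ∑ k : Fin 4 → Fin 4, ∑ l : Fin 4 → Fin 4, w' k * w l * ∏ i, projEntry (k i) (a i (l i))

lemma sum_prod_projEntry (x : Fin 4 → Equiv.Perm (Fin 4)) (k l k' l' : Fin 4 → Fin 4) :
    ∑ b : Fin 4 → Equiv.Perm (Fin 4),
      (∏ i, projEntry (k i) ((x * b⁻¹) i (l i))) * ∏ i, projEntry (k' i) (b i (l' i)) =
    8 ^ 4 * ((∏ i, projEntry (k i) (x i (l' i))) * ∏ i, projEntry (k' i) (l i)) := by
  have h (i : Fin 4) : ∑ β : Equiv.Perm (Fin 4),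
      projEntry (k i) ((x i * β⁻¹) (l i)) * projEntry (k' i) (β (l' i)) =
      8 * (projEntry (k i) (x i (l' i)) * projEntry (k' i) (l i)) := by
    rw [projEntry_apply_inv (x i), ← sum_projEntry_mul_projEntry]
    refine Finset.sum_congr rfl fun β _ => ?_
    rw [Equiv.Perm.mul_apply, projEntry_apply_inv (x i), projEntry_apply_inv β⁻¹, inv_inv]
  have h' := Finset.prod_congr rfl fun (i : Fin 4) (_ : i ∈ Finset.univ) => h i
  rw [Finset.prod_univ_sum, Fintype.piFinset_univ] at h'
  simpa [Finset.prod_mul_distrib] using h'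

lemma sum_matrixCoeff_mul_matrixCoeff (w w' v v' : (Fin 4 → Fin 4) → ℤ)
    (x : Fin 4 → Equiv.Perm (Fin 4)) :
    ∑ b, matrixCoeff w w' (x * b⁻¹) * matrixCoeff v v' b =
      8 ^ 4 * (matrixCoeff w v' 1 * matrixCoeff v w' x) := by
  calc _ = ∑ b : Fin 4 → Equiv.Perm (Fin 4), ∑ k, ∑ l, ∑ k', ∑ l',
        (w' k * w l * v' k' * v l') *
          ((∏ i, projEntry (k i) ((x * b⁻¹) i (l i))) *
            ∏ i, projEntry (k' i) (b i (l' i))) := by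
        simp only [matrixCoeff, Finset.sum_mul]
        simp only [Finset.mul_sum]
        refine Finset.sum_congr rfl fun b _ => Finset.sum_congr rfl fun k _ =>
          Finset.sum_congr rfl fun l _ => Finset.sum_congr rfl fun k' _ =>
          Finset.sum_congr rfl fun l' _ => ?_
        ring
    _ = ∑ k, ∑ l, ∑ k', ∑ l', (w' k * w l * v' k' * v l') *
          (8 ^ 4 * ((∏ i, projEntry (k i) (x i (l' i))) * ∏ i, projEntry (k' i) (l i))) := by
        simp_rw [← sum_prod_projEntry, Finset.mul_sum]
        rw [Finset.sum_comm]
        refine Finset.sum_congr rfl fun k _ => ?_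
        rw [Finset.sum_comm]
        refine Finset.sum_congr rfl fun l _ => ?_
        rw [Finset.sum_comm]
        refine Finset.sum_congr rfl fun k' _ => ?_
        rw [Finset.sum_comm]
    _ = ∑ k', ∑ l, ∑ k, ∑ l', (w' k * w l * v' k' * v l') *
          (8 ^ 4 * ((∏ i, projEntry (k i) (x i (l' i))) * ∏ i, projEntry (k' i) (l i))) := by
        rw [Finset.sum_comm, Finset.sum_congr rfl fun l _ => Finset.sum_comm, Finset.sum_comm]
    _ = _ := by
        simp only [matrixCoeff, Finset.sum_mul]
        simp only [Finset.mul_sum]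
        refine Finset.sum_congr rfl fun k' _ => Finset.sum_congr rfl fun l _ =>
          Finset.sum_congr rfl fun k _ => Finset.sum_congr rfl fun l' _ => ?_
        simp only [Pi.one_apply, Equiv.Perm.one_apply]
        ring

/-- The indicator function of the constant tuples. -/
def constWeight (k : Fin 4 → Fin 4) : ℤ := if ∀ i j, k i = k j then 1 else 0

/-- The indicator function of the injective tuples. -/
def injWeight (k : Fin 4 → Fin 4) : ℤ := if ∀ i j, k i = k j → i = j then 1 else 0

/-- Invariance of a function of tuples under relabelling of values and of positions. -/
def IsSymmWeight (w : (Fin 4 → Fin 4) → ℤ) : Prop :=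
  (∀ (γ : Equiv.Perm (Fin 4)) k, w (γ ∘ k) = w k) ∧
    ∀ (σ : Equiv.Perm (Fin 4)) k, w (k ∘ σ) = w k

lemma isSymmWeight_constWeight : IsSymmWeight constWeight := by
  refine ⟨fun γ k => by simp [constWeight], fun σ k => ?_⟩
  have h : (∀ i j, k (σ i) = k (σ j)) ↔ ∀ i j, k i = k j := by
    refine ⟨fun h i j => ?_, fun h i j => h _ _⟩
    simpa using h (σ⁻¹ i) (σ⁻¹ j)
  simp [constWeight, h]

lemma isSymmWeight_injWeight : IsSymmWeight injWeight := by
  refine ⟨fun γ k => by simp [injWeight], fun σ k => ?_⟩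
  have h : (∀ i j, k (σ i) = k (σ j) → i = j) ↔ ∀ i j, k i = k j → i = j := by
    refine ⟨fun h i j hij => ?_, fun h i j hij => σ.injective (h _ _ hij)⟩
    simpa using h (σ⁻¹ i) (σ⁻¹ j) (by simpa using hij)
  simp [injWeight, h]

lemma sum_mul_eq_list_sum {α : Type*} [Fintype α] [DecidableEq α] (w : α → ℤ) (L : List α)
    (hw : ∀ a, w a = L.count a) (g : α → ℤ) : ∑ a, w a * g a = (L.map g).sum := by
  rw [Finset.sum_list_map_count]
  simp_rw [nsmul_eq_mul, hw]
  symm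
  refine Finset.sum_subset (Finset.subset_univ _) fun a _ ha => ?_
  rw [List.count_eq_zero_of_not_mem (by simpa using ha)]
  simp

lemma matrixCoeff_eq_list_sum (w w' : (Fin 4 → Fin 4) → ℤ) (L L' : List (Fin 4 → Fin 4))
    (hw : ∀ k, w k = L.count k) (hw' : ∀ k, w' k = L'.count k)
    (a : Fin 4 → Equiv.Perm (Fin 4)) :
    matrixCoeff w w' a =
      (L'.map fun k => (L.map fun l => ∏ i, projEntry (k i) (a i (l i))).sum).sum := by
  rw [← sum_mul_eq_list_sum w' L' hw']
  simp_rw [← sum_mul_eq_list_sum w L hw, matrixCoeff, Finset.mul_sum, mul_assoc]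

lemma constWeight_eq_count (k : Fin 4 → Fin 4) :
    constWeight k = ((List.finRange 4).map fun c _ => c : List (Fin 4 → Fin 4)).count k := by
  revert k
  decide +kernel

lemma injWeight_eq_count (k : Fin 4 → Fin 4) : injWeight k = permList.count k := by
  revert k
  decide +kernel

lemma matrixCoeff_mul_ne :
    matrixCoeff constWeight constWeight 1 *
        matrixCoeff injWeight constWeight ![1, 1, Equiv.swap 2 3, Equiv.swap 2 3] ≠
      matrixCoeff injWeight constWeight 1 *
        matrixCoeff constWeight constWeight ![1, 1, Equiv.swap 2 3, Equiv.swap 2 3] := by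
  simp_rw [matrixCoeff_eq_list_sum _ _ _ _ constWeight_eq_count constWeight_eq_count,
    matrixCoeff_eq_list_sum _ _ _ _ injWeight_eq_count constWeight_eq_count]
  decide +kernel

lemma matrixCoeff_const_mul {w w' : (Fin 4 → Fin 4) → ℤ} (hw' : IsSymmWeight w')
    (δ : Equiv.Perm (Fin 4)) (a : Fin 4 → Equiv.Perm (Fin 4)) :
    matrixCoeff w w' ((fun _ => δ) * a) = matrixCoeff w w' a := by
  unfold matrixCoeff
  rw [← Equiv.sum_comp (Equiv.arrowCongr (Equiv.refl (Fin 4)) δ)]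
  refine Finset.sum_congr rfl fun k _ => Finset.sum_congr rfl fun l _ => ?_
  have h : Equiv.arrowCongr (Equiv.refl (Fin 4)) δ k = δ ∘ k := rfl
  simp [h, hw'.1, projEntry_perm]

lemma matrixCoeff_mul_const {w w' : (Fin 4 → Fin 4) → ℤ} (hw : IsSymmWeight w)
    (δ : Equiv.Perm (Fin 4)) (a : Fin 4 → Equiv.Perm (Fin 4)) :
    matrixCoeff w w' (a * fun _ => δ) = matrixCoeff w w' a := by
  unfold matrixCoeff
  refine Finset.sum_congr rfl fun k _ => ?_
  rw [← Equiv.sum_comp (Equiv.arrowCongr (Equiv.refl (Fin 4)) δ⁻¹)]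
  refine Finset.sum_congr rfl fun l _ => ?_
  have h : Equiv.arrowCongr (Equiv.refl (Fin 4)) δ⁻¹ l = ⇑δ⁻¹ ∘ l := rfl
  rw [h, hw.1]
  simp

lemma matrixCoeff_comp_perm {w w' : (Fin 4 → Fin 4) → ℤ} (hw : IsSymmWeight w)
    (hw' : IsSymmWeight w') (σ : Equiv.Perm (Fin 4)) (a : Fin 4 → Equiv.Perm (Fin 4)) :
    matrixCoeff w w' (a ∘ σ) = matrixCoeff w w' a := by
  unfold matrixCoeff
  rw [← Equiv.sum_comp (Equiv.arrowCongr σ⁻¹ (Equiv.refl (Fin 4)))]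
  refine Finset.sum_congr rfl fun k _ => ?_
  rw [← Equiv.sum_comp (Equiv.arrowCongr σ⁻¹ (Equiv.refl (Fin 4)))]
  refine Finset.sum_congr rfl fun l _ => ?_
  have h (k : Fin 4 → Fin 4) : Equiv.arrowCongr σ⁻¹ (Equiv.refl (Fin 4)) k = k ∘ σ := rfl
  rw [h, h, hw.2, hw'.2, ← Equiv.prod_comp σ fun i => projEntry (k i) (a i (l i))]
  rfl

end Combinatorics

section WreathProduct

/-- The function on `G_4` attached to two tensors with coordinates `w`, `w'`. -/
def wreathCoeff (w w' : (Fin 4 → Fin 4) → ℤ) (g : Gn (Equiv.Perm (Fin 4)) 4) : ℂ :=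
  matrixCoeff w w' g.left

lemma isBiinvariant_wreathCoeff {w w' : (Fin 4 → Fin 4) → ℤ} (hw : IsSymmWeight w)
    (hw' : IsSymmWeight w') :
    IsBiinvariant (Kn (Equiv.Perm (Fin 4)) 4) (wreathCoeff w w') := by
  rintro k₁ ⟨γ, h₁⟩ k₂ ⟨δ, h₂⟩ x
  have h : (k₁ * x * k₂).left = (fun _ => γ) * (x.left ∘ k₁.right.symm) * fun _ => δ := by
    rw [SemidirectProduct.mul_left, SemidirectProduct.mul_left, h₁, h₂]
    rfl
  rw [wreathCoeff, h, matrixCoeff_mul_const hw, matrixCoeff_const_mul hw',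
    matrixCoeff_comp_perm hw hw', wreathCoeff]

/-- Every element of `G_n` is uniquely the product of a permutation and an element of `Γ^n`. -/
def permMulEquiv (Γ : Type) [Group Γ] (n : ℕ) :
    Equiv.Perm (Fin n) × (Fin n → Γ) ≃ Gn Γ n where
  toFun p := SemidirectProduct.inr p.1 * SemidirectProduct.inl p.2
  invFun g := (g.right, permHom Γ n g.right⁻¹ g.left)
  left_inv p := by ext <;> simp
  right_inv g := by ext <;> simp

lemma conv_wreathCoeff_inl {w w' v v' : (Fin 4 → Fin 4) → ℤ} (hw : IsSymmWeight w)
    (hw' : IsSymmWeight w') (hv : IsSymmWeight v) (hv' : IsSymmWeight v')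
    (a : Fin 4 → Equiv.Perm (Fin 4)) :
    conv (wreathCoeff w w') (wreathCoeff v v') (SemidirectProduct.inl a) =
      (Fintype.card (Gn (Equiv.Perm (Fin 4)) 4) : ℂ)⁻¹ *
        (Fintype.card (Equiv.Perm (Fin 4)) *
          ((8 ^ 4 * (matrixCoeff w v' 1 * matrixCoeff v w' a) : ℤ) : ℂ)) := by
  have hK (ρ : Equiv.Perm (Fin 4)) :
      (SemidirectProduct.inr ρ : Gn (Equiv.Perm (Fin 4)) 4) ∈ Kn (Equiv.Perm (Fin 4)) 4 :=
    ⟨1, rfl⟩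
  have h1 := (Kn (Equiv.Perm (Fin 4)) 4).one_mem
  unfold conv
  rw [← Equiv.sum_comp (permMulEquiv (Equiv.Perm (Fin 4)) 4), Fintype.sum_prod_type,
    ← sum_matrixCoeff_mul_matrixCoeff]
  congr 1
  have h (ρ : Equiv.Perm (Fin 4)) (b : Fin 4 → Equiv.Perm (Fin 4)) :
      wreathCoeff w w' (SemidirectProduct.inl a *
          (permMulEquiv (Equiv.Perm (Fin 4)) 4 (ρ, b))⁻¹) *
        wreathCoeff v v' (permMulEquiv (Equiv.Perm (Fin 4)) 4 (ρ, b)) =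
      ((matrixCoeff w w' (a * b⁻¹) * matrixCoeff v v' b : ℤ) : ℂ) := by
    have e1 := isBiinvariant_wreathCoeff hw hw' _ h1 _ (hK ρ⁻¹)
      (SemidirectProduct.inl (a * b⁻¹))
    have e2 := isBiinvariant_wreathCoeff hv hv' _ (hK ρ) _ h1 (SemidirectProduct.inl b)
    rw [one_mul] at e1
    rw [mul_one] at e2
    have e3 : SemidirectProduct.inl a * (permMulEquiv (Equiv.Perm (Fin 4)) 4 (ρ, b))⁻¹ =
        SemidirectProduct.inl (a * b⁻¹) * SemidirectProduct.inr ρ⁻¹ := by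
      simp [permMulEquiv, mul_assoc]
    rw [e3, e1]
    erw [e2]
    simp [wreathCoeff]
  simp_rw [h]
  simp

lemma not_isGelfandPair :
    ¬ IsGelfandPair (Gn (Equiv.Perm (Fin 4)) 4) (Kn (Equiv.Perm (Fin 4)) 4) := by
  intro h
  have hc := isSymmWeight_constWeight
  have hi := isSymmWeight_injWeight
  have h' := congrFun (h _ _ (isBiinvariant_wreathCoeff hc hc) (isBiinvariant_wreathCoeff hi hc))
    (SemidirectProduct.inl ![1, 1, Equiv.swap 2 3, Equiv.swap 2 3])
  rw [conv_wreathCoeff_inl hc hc hi hc, conv_wreathCoeff_inl hi hc hc hc,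
    mul_right_inj' (inv_ne_zero (Nat.cast_ne_zero.mpr Fintype.card_ne_zero)),
    mul_right_inj' (Nat.cast_ne_zero.mpr Fintype.card_ne_zero), Int.cast_inj,
    mul_right_inj' (by norm_num)] at h'
  exact matrixCoeff_mul_ne h'

end WreathProduct

section Trace

/-- The first three coordinates on `zeroSum`. -/
def zeroSumEquiv : zeroSum ≃ₗ[ℂ] (Fin 3 → ℂ) where
  toFun x i := x.1 i.castSucc
  map_add' _ _ := rfl
  map_smul' _ _ := rfl
  invFun y := ⟨![y 0, y 1, y 2, -(y 0 + y 1 + y 2)], by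
    simp [zeroSum, sumFunctional, Fin.sum_univ_four]⟩
  left_inv x := by
    have hx : x.1 0 + x.1 1 + x.1 2 + x.1 3 = 0 := by
      have := x.2
      simpa [zeroSum, sumFunctional, Fin.sum_univ_four] using this
    ext i
    fin_cases i
    · rfl
    · rfl
    · rfl
    · exact (eq_neg_of_add_eq_zero_right hx).symm
  right_inv y := by
    ext i
    fin_cases i <;> rfl

/-- The basis `e_j - e_3` of `std`. -/
def stdBasis : Module.Basis (Fin 3) ℂ (stdFDRep : Type) :=
  Module.Basis.ofEquivFun zeroSumEquiv

lemma stdBasis_coord (j : Fin 3) (k : Fin 4) :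
    (stdBasis j : zeroSum).1 k =
      (if k = j.castSucc then 1 else 0) - (if k = 3 then 1 else 0) := by
  have h : (stdBasis j : zeroSum) = zeroSumEquiv.symm (Pi.single j 1) := by
    refine (LinearEquiv.eq_symm_apply _).mpr (funext fun i => ?_)
    have h' : zeroSumEquiv (stdBasis j : zeroSum) i = stdBasis.repr (stdBasis j) i := rfl
    refine h'.trans ?_
    rw [Module.Basis.repr_self, Finsupp.single_eq_pi_single]
  rw [h]
  fin_cases j <;> fin_cases k <;> simp [zeroSumEquiv]

lemma stdBasis_repr_rho (γ : Equiv.Perm (Fin 4)) (i j : Fin 3) :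
    stdBasis.repr (stdFDRep.ρ γ (stdBasis j)) i = stdEntry γ i j := by
  have h : stdBasis.repr (stdFDRep.ρ γ (stdBasis j)) i =
      (stdBasis j : zeroSum).1 (γ.symm i.castSucc) := rfl
  rw [h, stdBasis_coord, stdEntry]
  simp [Equiv.symm_apply_eq, eq_comm (a := i.castSucc)]

lemma chiPiOmega_std (γ : Equiv.Perm (Fin 4)) (σ : stab (fun _ : Fin 4 => ())) :
    chiPiOmega (fun _ : Unit => stdFDRep) (fun _ : Fin 4 => ()) (fun _ => γ) σ =
      tensorTrace (stdEntry γ) (σ : Equiv.Perm (Fin 4))⁻¹ := by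
  rw [chiPiOmega, LinearMap.trace_eq_matrix_trace ℂ (Basis.piTensorProduct fun _ => stdBasis),
    Matrix.trace, tensorTrace]
  push_cast
  refine Finset.sum_congr rfl fun f _ => ?_
  rw [Matrix.diag_apply, LinearMap.toMatrix_apply, Basis.piTensorProduct_apply,
    LinearMap.comp_apply, permOp, LinearEquiv.coe_coe, LinearEquiv.trans_apply,
    PiTensorProduct.reindex_tprod, PiTensorProduct.congr_tprod, PiTensorProduct.map_tprod,
    Basis.piTensorProduct_repr_tprod_apply]
  exact Finset.prod_congr rfl fun i _ => stdBasis_repr_rho γ _ _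

lemma stab_const {n : ℕ} : stab (fun _ : Fin n => ()) = ⊤ :=
  top_unique fun _ _ _ => rfl

/-- The stabilizer of a constant labelling is the full symmetric group. -/
def stabConstEquiv (n : ℕ) : stab (fun _ : Fin n => ()) ≃ Equiv.Perm (Fin n) :=
  Equiv.subtypeUnivEquiv fun _ _ => rfl

lemma sum_sum_chiPiOmega_std :
    ∑ σ : stab (fun _ : Fin 4 => ()), ∑ γ : Equiv.Perm (Fin 4),
      chiPiOmega (fun _ : Unit => stdFDRep) (fun _ : Fin 4 => ()) (fun _ => γ) σ = 1152 := by
  simp_rw [chiPiOmega_std]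
  refine (Fintype.sum_equiv ((stabConstEquiv 4).trans (Equiv.inv _)) _
    (fun σ : Equiv.Perm (Fin 4) =>
      ∑ γ : Equiv.Perm (Fin 4), (tensorTrace (stdEntry γ) σ : ℂ)) fun _ => rfl).trans ?_
  have h := congrArg (Int.cast : ℤ → ℂ) sum_sum_tensorTrace_stdEntry
  push_cast at h
  convert h

lemma card_stab_const : Fintype.card (stab (fun _ : Fin 4 => ())) = 24 := by
  rw [Fintype.card_congr (stabConstEquiv 4), Fintype.card_perm, Fintype.card_fin]
  rfl

lemma sum_Mpi_std :
    ∑ σ : stab (fun _ : Fin 4 => ()),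
      Mpi (fun _ : Unit => stdFDRep) (fun _ : Fin 4 => ()) σ = 48 := by
  simp_rw [Mpi]
  rw [← Finset.mul_sum, sum_sum_chiPiOmega_std, Fintype.card_perm, Fintype.card_fin]
  norm_num [Nat.factorial]

end Trace

/-- The trivial one-dimensional representation. -/
def trivialFDRep (G : Type) [Group G] : FDRep ℂ G := FDRep.of (1 : Representation ℂ G ℂ)

lemma trivialFDRep_character (G : Type) [Group G] (g : G) :
    (trivialFDRep G).character g = 1 := by
  have : (trivialFDRep G).character g = LinearMap.trace ℂ ℂ 1 := rfl
  rw [this]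
  simp

lemma simple_trivialFDRep (G : Type) [Group G] [Finite G] : Simple (trivialFDRep G) := by
  have := Fintype.ofFinite G
  rw [FDRep.simple_iff_char_is_norm_one]
  simp [trivialFDRep_character]

/-- Take `π = std ⊗̂ std ⊗̂ std ⊗̂ std`, encoded by the constant labelling
`ℓ : Fin 4 → Unit`. Its stabilizer `S_π` is all of `S_4`, there is an irreducible
representation `ρ` of `S_π` with `⟨M_π, χ_ρ⟩ ≥ 2`, and consequently `(G_4, K_4)` is not a
Gelfand pair for `Γ = S_4`. -/
theorem std_fourth_power_not_gelfand :
    stab (fun _ : Fin 4 => ()) = ⊤ ∧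
      (∃ ρ : FDRep ℂ (stab (fun _ : Fin 4 => ())), Simple ρ ∧
        (2 : ℝ) ≤ ((Fintype.card (stab (fun _ : Fin 4 => ())) : ℂ)⁻¹ *
          ∑ σ : stab (fun _ : Fin 4 => ()),
            Mpi (fun _ : Unit => stdFDRep) (fun _ : Fin 4 => ()) σ * star (ρ.character σ)).re) ∧
      ¬ IsGelfandPair (Gn (Equiv.Perm (Fin 4)) 4) (Kn (Equiv.Perm (Fin 4)) 4) := by
  refine ⟨stab_const, ⟨trivialFDRep _, simple_trivialFDRep _, ?_⟩, not_isGelfandPair⟩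
  simp_rw [trivialFDRep_character, star_one, mul_one]
  rw [sum_Mpi_std, card_stab_const]
  norm_num
end
end
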